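/- arXiv:2411.13374 — 4 statements merged into one kernel-verified Lean document; each statement's English description precedes it below -/
import Mathlib

section
/- Let G be a connected finite simple graph that admits a chord model and has no non-trivial split. Then G has, up to rotation, exactly two chord models, one being the reflection of the other; that is, for any two chord models w and w' of G, either w' is equivalent to w or w' is equivalent to the reflection of w. -/
/-- The two occurrences of `u` and the two occurrences of `v` alternate in the
(cyclic) word represented by the list `l`: for the positions `i₁ < i₂` of `u` and
`j₁ < j₂` of `v`, exactly one occurrence of `v` lies strictly between the two
occurrences of `u` (this linear condition is invariant under rotation). -/
def ChordsAlternate {V : Type*} (l : List V) (u v : V) : Prop :=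
  ∀ i₁ i₂ j₁ j₂ : Fin l.length, i₁ < i₂ → j₁ < j₂ →
    l.get i₁ = u → l.get i₂ = u → l.get j₁ = v → l.get j₂ = v →
    ((i₁ < j₁ ∧ j₁ < i₂ ∧ i₂ < j₂) ∨ (j₁ < i₁ ∧ i₁ < j₂ ∧ j₂ < i₂))

/-- `l` is a chord model of the graph `G` restricted to the vertex set `S`:
every vertex of `S` occurs exactly twice in `l`, no other vertex occurs, and two
distinct vertices of `S` are adjacent iff their occurrences alternate in cyclic
order. -/
def IsChordModelOn {V : Type*} [DecidableEq V] (G : SimpleGraph V) (S : Finset V)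
    (l : List V) : Prop :=
  (∀ v ∈ S, l.count v = 2) ∧ (∀ v : V, v ∉ S → l.count v = 0) ∧
    ∀ u ∈ S, ∀ v ∈ S, u ≠ v → (G.Adj u v ↔ ChordsAlternate l u v)

/-- `l` is a chord model of `G`. -/
def IsChordModel {V : Type*} [Fintype V] [DecidableEq V] (G : SimpleGraph V)
    (l : List V) : Prop :=
  IsChordModelOn G Finset.univ l

/-- `(A, αA, B, αB)` is a split of `G`. -/
def IsSplit {V : Type*} [Fintype V] [DecidableEq V] (G : SimpleGraph V)
    (A αA B αB : Finset V) : Prop :=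
  A.Nonempty ∧ B.Nonempty ∧
  Disjoint A αA ∧ Disjoint A B ∧ Disjoint A αB ∧
  Disjoint αA B ∧ Disjoint αA αB ∧ Disjoint B αB ∧
  A ∪ αA ∪ B ∪ αB = Finset.univ ∧
  (∀ a ∈ A, ∀ b ∈ B, G.Adj a b) ∧
  (∀ u ∈ αA, ∀ v ∈ B ∪ αB, ¬ G.Adj u v) ∧
  (∀ u ∈ αB, ∀ v ∈ A ∪ αA, ¬ G.Adj u v)

section EdgeLists

variable {V : Type*} [DecidableEq V]

/-- The degree of `x` in the multigraph with edge list `E` (a loop counts twice). -/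
def edgeDeg (E : List (V × V)) (x : V) : ℕ :=
  (E.map fun p => (if p.1 = x then 1 else 0) + (if p.2 = x then 1 else 0)).sum

/-- The number of edges in `E` with exactly one end in `A`. -/
def edgeCut (E : List (V × V)) (A : Finset V) : ℕ :=
  (E.map fun p => if (p.1 ∈ A ↔ p.2 ∈ A) then 0 else 1).sum

/-- The number of edges in `E` joining `x` and `y`. -/
def edgeMul (E : List (V × V)) (x y : V) : ℕ :=
  (E.map fun p => if (p.1 = x ∧ p.2 = y) ∨ (p.1 = y ∧ p.2 = x) then 1 else 0).sum

@[simp] lemma edgeDeg_nil (x : V) : edgeDeg [] x = 0 := rfl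
@[simp] lemma edgeCut_nil (A : Finset V) : edgeCut [] A = 0 := rfl
@[simp] lemma edgeMul_nil (x y : V) : edgeMul [] x y = 0 := rfl

@[simp] lemma edgeDeg_cons (p : V × V) (E : List (V × V)) (x : V) :
    edgeDeg (p :: E) x
      = ((if p.1 = x then 1 else 0) + (if p.2 = x then 1 else 0)) + edgeDeg E x := by
  simp [edgeDeg]

@[simp] lemma edgeCut_cons (p : V × V) (E : List (V × V)) (A : Finset V) :
    edgeCut (p :: E) A = (if (p.1 ∈ A ↔ p.2 ∈ A) then 0 else 1) + edgeCut E A := by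
  simp [edgeCut]

@[simp] lemma edgeMul_cons (p : V × V) (E : List (V × V)) (x y : V) :
    edgeMul (p :: E) x y
      = (if (p.1 = x ∧ p.2 = y) ∨ (p.1 = y ∧ p.2 = x) then 1 else 0) + edgeMul E x y := by
  simp [edgeMul]

lemma edgeMul_comm (E : List (V × V)) (x y : V) : edgeMul E x y = edgeMul E y x := by
  induction E with
  | nil => rfl
  | cons p E ih => simp only [edgeMul_cons, ih, or_comm]

lemma edgeCut_submodular (E : List (V × V)) (A B : Finset V) :
    edgeCut E (A ∩ B) + edgeCut E (A ∪ B) ≤ edgeCut E A + edgeCut E B := by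
  induction E with
  | nil => simp
  | cons p E ih =>
    simp only [edgeCut_cons, Finset.mem_inter, Finset.mem_union]
    by_cases h1 : p.1 ∈ A <;> by_cases h2 : p.2 ∈ A <;> by_cases h3 : p.1 ∈ B <;>
      by_cases h4 : p.2 ∈ B <;> simp [h1, h2, h3, h4] <;> omega

lemma edgeCut_compl {E : List (V × V)} {S : Finset V} (hE : ∀ p ∈ E, p.1 ∈ S ∧ p.2 ∈ S)
    (A : Finset V) : edgeCut E (S \ A) = edgeCut E A := by
  induction E with
  | nil => simp
  | cons p E ih =>
    simp only [List.forall_mem_cons] at hE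
    simp [ih hE.2, hE.1, not_iff_not]

/-- Degrees of the members of a pair, in terms of the cut around the pair. -/
lemma edgeCut_pair (E : List (V × V)) {x y : V} (hxy : x ≠ y) :
    edgeCut E {x, y} + 2 * edgeMul E x y + edgeMul E x x * 2 + edgeMul E y y * 2
      = edgeDeg E x + edgeDeg E y := by
  induction E with
  | nil => simp
  | cons p E ih =>
    simp only [edgeCut_cons, edgeMul_cons, edgeDeg_cons, Finset.mem_insert, Finset.mem_singleton]
    by_cases h1 : p.1 = x <;> by_cases h2 : p.2 = x <;> by_cases h3 : p.1 = y <;>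
      by_cases h4 : p.2 = y <;> simp [h1, h2, h3, h4, hxy, hxy.symm] <;> grind

/-- The number of edges joining `v` to the set `A`. -/
def edgeMulSet (E : List (V × V)) (v : V) (A : Finset V) : ℕ := ∑ a ∈ A, edgeMul E v a

lemma sum_edgeMul_aux (p : V × V) (v : V) (A : Finset V) (hv : v ∉ A) :
    (∑ a ∈ A, if (p.1 = v ∧ p.2 = a) ∨ (p.1 = a ∧ p.2 = v) then 1 else 0)
      = (if p.1 = v ∧ p.2 ∈ A then 1 else 0) + (if p.2 = v ∧ p.1 ∈ A then 1 else 0) := by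
  by_cases h1 : p.1 = v <;> by_cases h2 : p.2 = v
  · simp [h1, h2, hv]
  · simp [h1, h2]
  · simp [h1, h2]
  · simp [h1, h2]

lemma edgeCut_insert (E : List (V × V)) (v : V) (A : Finset V) (hv : v ∉ A) :
    edgeCut E (insert v A) + 2 * edgeMulSet E v A + 2 * edgeMul E v v
      = edgeCut E A + edgeDeg E v := by
  induction E with
  | nil => simp [edgeMulSet]
  | cons p E ih =>
    simp only [edgeMulSet] at ih ⊢
    simp only [edgeCut_cons, edgeMul_cons, edgeDeg_cons, Finset.sum_add_distrib,
      sum_edgeMul_aux p v A hv, Finset.mem_insert]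
    by_cases h1 : p.1 = v <;> by_cases h2 : p.2 = v
    · simp [h1, h2, hv]; omega
    · by_cases h3 : p.2 ∈ A <;> simp [h1, h2, h3, hv] <;> omega
    · by_cases h3 : p.1 ∈ A <;> simp [h1, h2, h3, hv] <;> omega
    · by_cases h3 : p.1 ∈ A <;> by_cases h4 : p.2 ∈ A <;> simp [h1, h2, h3, h4] <;> omega

lemma edgeMulSet_erase {E : List (V × V)} {S : Finset V} (hE : ∀ p ∈ E, p.1 ∈ S ∧ p.2 ∈ S)
    (v : V) : edgeMulSet E v (S.erase v) + 2 * edgeMul E v v = edgeDeg E v := by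
  induction E with
  | nil => simp [edgeMulSet]
  | cons p E ih =>
    simp only [List.forall_mem_cons] at hE
    have ih := ih hE.2
    simp only [edgeMulSet] at ih ⊢
    simp only [edgeMul_cons, edgeDeg_cons, Finset.sum_add_distrib,
      sum_edgeMul_aux p v _ (Finset.notMem_erase v S), Finset.mem_erase, hE.1, and_true]
    by_cases h1 : p.1 = v <;> by_cases h2 : p.2 = v <;> simp [h1, h2] <;> omega

lemma edgeCut_even {E : List (V × V)} {A : Finset V} (h : ∀ x ∈ A, Even (edgeDeg E x)) :
    Even (edgeCut E A) := by
  induction A using Finset.induction_on with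
  | empty =>
    have : edgeCut E ∅ = 0 := by simp [edgeCut]
    simp [this]
  | insert v A hv ih =>
    have h1 := ih fun x hx => h x (Finset.mem_insert_of_mem hx)
    have h2 := h v (Finset.mem_insert_self v A)
    have h3 := edgeCut_insert E v A hv
    grind

/-- A 4-regular multigraph on `S` in which every set `A` with at least two vertices inside and
outside is left by at least six edges. -/
structure IsPrimeEdgeList (S : Finset V) (E : List (V × V)) : Prop where
  mem : ∀ p ∈ E, p.1 ∈ S ∧ p.2 ∈ S
  deg : ∀ x ∈ S, edgeDeg E x = 4
  cut : ∀ A ⊆ S, 2 ≤ A.card → 2 ≤ (S \ A).card → 6 ≤ edgeCut E A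

namespace IsPrimeEdgeList

variable {S : Finset V} {E : List (V × V)}

lemma cut_pair (h : IsPrimeEdgeList S E) (hS : 4 ≤ S.card) {x y : V} (hx : x ∈ S) (hy : y ∈ S)
    (hxy : x ≠ y) : edgeMul E x y + edgeMul E x x + edgeMul E y y ≤ 1 := by
  have hsub : ({x, y} : Finset V) ⊆ S := by grind
  have hc : ({x, y} : Finset V).card = 2 := Finset.card_pair hxy
  have h1 := h.cut {x, y} hsub hc.ge (by rw [Finset.card_sdiff_of_subset hsub]; omega)
  have h2 := edgeCut_pair E hxy
  rw [h.deg x hx, h.deg y hy] at h2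
  omega

lemma mul_self (h : IsPrimeEdgeList S E) (hS : 4 ≤ S.card) {x : V} (hx : x ∈ S) :
    edgeMul E x x = 0 := by
  by_contra hne
  have h1 : ∀ y ∈ S.erase x, edgeMul E x y = 0 := by
    intro y hy
    have := h.cut_pair hS hx (Finset.mem_of_mem_erase hy) (Finset.ne_of_mem_erase hy).symm
    omega
  have h2 := edgeMulSet_erase h.mem x
  rw [edgeMulSet, Finset.sum_eq_zero h1, h.deg x hx] at h2
  obtain ⟨y, hy⟩ : (S.erase x).Nonempty := by
    rw [← Finset.card_pos, Finset.card_erase_of_mem hx]; omega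
  have := h.cut_pair hS hx (Finset.mem_of_mem_erase hy) (Finset.ne_of_mem_erase hy).symm
  omega

lemma mul_le (h : IsPrimeEdgeList S E) (hS : 4 ≤ S.card) {x y : V} (hx : x ∈ S) (hy : y ∈ S) :
    edgeMul E x y ≤ 1 := by
  by_cases hxy : x = y
  · subst hxy; rw [h.mul_self hS hx]; omega
  · have := h.cut_pair hS hx hy hxy; omega

/-- `N` lists the neighbors of `v`, each joined to `v` by a single edge. -/
structure IsNeighborList (S : Finset V) (E : List (V × V)) (v : V) (N : List V) : Prop where
  nodup : (v :: N).Nodup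
  mul_mem : ∀ x ∈ N, x ∈ S ∧ edgeMul E v x = 1
  mul_notMem : ∀ x ∈ S, x ∉ N → edgeMul E v x = 0

lemma IsNeighborList.perm {v : V} {N N' : List V} (h : IsNeighborList S E v N) (hp : N.Perm N') :
    IsNeighborList S E v N' where
  nodup := (hp.cons v).nodup_iff.1 h.nodup
  mul_mem x hx := h.mul_mem x (hp.mem_iff.2 hx)
  mul_notMem x hx hxn := h.mul_notMem x hx fun hx' => hxn (hp.mem_iff.1 hx')

lemma exists_neighbors (h : IsPrimeEdgeList S E) (hS : 4 ≤ S.card) {v : V} (hv : v ∈ S) :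
    ∃ a b c d : V, IsNeighborList S E v [a, b, c, d] := by
  have h2 := edgeMulSet_erase h.mem v
  rw [h.mul_self hS hv, h.deg v hv, edgeMulSet] at h2
  set N := (S.erase v).filter fun x => edgeMul E v x = 1 with hN
  have h3 : ∑ a ∈ S.erase v, edgeMul E v a = N.card := by
    rw [hN, Finset.card_filter]
    refine Finset.sum_congr rfl fun x hx => ?_
    have := h.mul_le hS hv (Finset.mem_of_mem_erase hx)
    split_ifs <;> omega
  have h4 : N.card = 4 := by omega
  obtain ⟨a, N1, ha, rfl', h5⟩ := Finset.card_eq_succ.1 h4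
  obtain ⟨b, c, d, hbc, hbd, hcd, rfl⟩ := Finset.card_eq_three.1 h5
  have hmem : ∀ x, x ∈ [a, b, c, d] ↔ x ∈ N := by
    intro x; rw [← rfl']; simp
  refine ⟨a, b, c, d, ?_, ?_, ?_⟩
  · have hvN : v ∉ N := by simp [hN]
    rw [← hmem] at hvN
    simp only [List.nodup_cons, hvN, not_false_eq_true, true_and]
    simp at ha ⊢
    tauto
  · intro x hx
    rw [hmem, hN] at hx
    simp at hx
    tauto
  · intro x hx hxn
    rw [hmem, hN] at hxn
    by_cases hxv : x = v
    · subst hxv; exact h.mul_self hS hx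
    · have := h.mul_le hS hv hx
      simp at hxn
      have := hxn hxv hx
      omega

end IsPrimeEdgeList

end EdgeLists

section Chain

variable {V : Type*} [DecidableEq V]

namespace IsPrimeEdgeList

variable {S : Finset V} {E : List (V × V)}

lemma IsNeighborList.mulSet {v a b c d : V} (hN : IsNeighborList S E v [a, b, c, d])
    {A : Finset V} (hA : A ⊆ S) :
    edgeMulSet E v A = (if a ∈ A then 1 else 0) + (if b ∈ A then 1 else 0)
      + (if c ∈ A then 1 else 0) + (if d ∈ A then 1 else 0) := by
  have hnd := hN.nodup
  simp only [List.nodup_cons, List.mem_cons, List.not_mem_nil, or_false, not_or] at hnd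
  have h1 : ∀ x ∈ A, edgeMul E v x = (if a = x then 1 else 0) + (if b = x then 1 else 0)
      + (if c = x then 1 else 0) + (if d = x then 1 else 0) := by
    intro x hx
    by_cases hxN : x ∈ [a, b, c, d]
    · rw [(hN.mul_mem x hxN).2]
      simp only [List.mem_cons, List.not_mem_nil, or_false] at hxN
      rcases hxN with rfl | rfl | rfl | rfl <;> grind
    · rw [hN.mul_notMem x (hA hx) hxN]
      simp only [List.mem_cons, List.not_mem_nil, or_false, not_or] at hxN
      grind
  rw [edgeMulSet, Finset.sum_congr rfl h1]
  simp [Finset.sum_add_distrib]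

/-- Splitting off `v` along the pairing `ab|cd` of its neighbors destroys primality. -/
def IsBad (S : Finset V) (E : List (V × V)) (v a b c d : V) : Prop :=
  ∃ A ⊆ S, v ∉ A ∧ a ∈ A ∧ b ∈ A ∧ c ∉ A ∧ d ∉ A ∧ edgeCut E A ≤ 6

lemma cut_insert_nbr (h : IsPrimeEdgeList S E) (hS : 4 ≤ S.card) {v a b c d : V} (hv : v ∈ S)
    (hN : IsNeighborList S E v [a, b, c, d]) {A : Finset V} (hA : A ⊆ S) (hvA : v ∉ A) :
    edgeCut E (insert v A) + 2 * ((if a ∈ A then 1 else 0) + (if b ∈ A then 1 else 0)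
      + (if c ∈ A then 1 else 0) + (if d ∈ A then 1 else 0)) = edgeCut E A + 4 := by
  have h1 := edgeCut_insert E v A hvA
  rw [h.deg v hv, h.mul_self hS hv, hN.mulSet hA] at h1
  omega

lemma cut_compl_insert (h : IsPrimeEdgeList S E) (hS : 4 ≤ S.card) {v a b c d : V} (hv : v ∈ S)
    (hN : IsNeighborList S E v [a, b, c, d]) {A : Finset V} (hA : A ⊆ S) (hvA : v ∉ A)
    (ha : a ∈ A) (hb : b ∈ A) (hc : c ∉ A) (hd : d ∉ A) :
    edgeCut E (S \ insert v A) = edgeCut E A := by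
  rw [edgeCut_compl h.mem]
  have := h.cut_insert_nbr hS hv hN hA hvA
  simp only [ha, hb, hc, hd, if_true, if_false] at this
  omega

lemma IsBad.compl (h : IsPrimeEdgeList S E) (hS : 4 ≤ S.card) {v a b c d : V} (hv : v ∈ S)
    (hN : IsNeighborList S E v [a, b, c, d]) (hb : IsBad S E v a b c d) :
    IsBad S E v c d a b := by
  obtain ⟨A, hA, hvA, h1, h2, h3, h4, h5⟩ := hb
  have hnd := hN.nodup
  simp only [List.nodup_cons, List.mem_cons, List.not_mem_nil, or_false, not_or] at hnd
  have hc := (hN.mul_mem c (by simp)).1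
  have hd := (hN.mul_mem d (by simp)).1
  refine ⟨S \ insert v A, Finset.sdiff_subset, by simp, ?_, ?_, ?_, ?_, ?_⟩
  · simp [hc, h3]; grind
  · simp [hd, h4]; grind
  · simp [h1]
  · simp [h2]
  · rw [h.cut_compl_insert hS hv hN hA hvA h1 h2 h3 h4]; exact h5

/-- Uncrossing of two sets leaving at most one neighbor of `v` outside. -/
lemma uncross (h : IsPrimeEdgeList S E) (hS : 4 ≤ S.card) {v a b c d : V} (hv : v ∈ S)
    (hN : IsNeighborList S E v [a, b, c, d]) {A B : Finset V} (hA : A ⊆ S) (hB : B ⊆ S)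
    (hvA : v ∉ A) (hvB : v ∉ B) (ha : a ∈ A ∪ B) (hb : b ∈ A ∪ B) (hc : c ∈ A ∪ B)
    (hd : d ∉ A ∪ B)
    (hcA : edgeCut E A ≤ 6) (hcB : edgeCut E B ≤ 6) :
    (A ∩ B).card ≤ 1 ∨ (S \ insert v (A ∪ B)).card ≤ 1 := by
  by_contra! hcon
  have hAB : A ∪ B ⊆ S := Finset.union_subset hA hB
  have hvAB : v ∉ A ∪ B := by simp [hvA, hvB]
  have hdisj : Disjoint (A ∩ B) (S \ insert v (A ∪ B)) := by
    rw [Finset.disjoint_left]; intro x hx; simp at hx ⊢; tauto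
  have h1 : 6 ≤ edgeCut E (A ∩ B) := by
    refine h.cut _ (fun x hx => hA (Finset.mem_inter.1 hx).1) hcon.1 ?_
    refine le_trans (b := (S \ insert v (A ∪ B)).card) hcon.2 (Finset.card_le_card ?_)
    intro x hx; simp at hx ⊢; tauto
  have h2 : 6 ≤ edgeCut E (S \ insert v (A ∪ B)) := by
    refine h.cut _ Finset.sdiff_subset hcon.2 ?_
    refine le_trans (b := (A ∩ B).card) hcon.1 (Finset.card_le_card ?_)
    intro x hx
    have := hA (Finset.mem_inter.1 hx).1
    simp at hx ⊢; tauto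
  rw [edgeCut_compl h.mem] at h2
  have h3 := h.cut_insert_nbr hS hv hN hAB hvAB
  simp only [ha, hb, hc, hd, if_true, if_false] at h3
  have h4 := edgeCut_submodular E A B
  omega

lemma mul_of_card_eq_two (h : IsPrimeEdgeList S E) (hS : 4 ≤ S.card) {a b : V} {A : Finset V}
    (ha : a ∈ A) (hb : b ∈ A) (hab : a ≠ b) (hA : A ⊆ S)
    (h2 : A.card ≤ 2) (hcut : edgeCut E A ≤ 6) : edgeMul E a b = 1 := by
  have : A = {a, b} := by
    symm
    apply Finset.eq_of_subset_of_card_le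
    · grind
    · rw [Finset.card_pair hab]; exact h2
  subst this
  have h1 := edgeCut_pair E hab
  have haS := hA ha
  have hbS := hA hb
  rw [h.deg a haS, h.deg b hbS, h.mul_self hS haS, h.mul_self hS hbS] at h1
  have := h.mul_le hS haS hbS
  omega

/-- If two pairings are bad then one of them is bad because of a triangle at `v`. -/
lemma triangle_of_bad (h : IsPrimeEdgeList S E) (hS : 4 ≤ S.card) {v a b c d : V} (hv : v ∈ S)
    (hN : IsNeighborList S E v [a, b, c, d]) (h1 : IsBad S E v a b c d)
    (h2 : IsBad S E v a c b d) :
    (edgeMul E a b = 1 ∨ edgeMul E c d = 1) ∨ (edgeMul E a c = 1 ∨ edgeMul E b d = 1) := by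
  have hnd := hN.nodup
  simp only [List.nodup_cons, List.mem_cons, List.not_mem_nil, or_false, not_or] at hnd
  obtain ⟨A, hA, hvA, haA, hbA, hcA, hdA, hcutA⟩ := h1
  obtain ⟨B, hB, hvB, haB, hcB, hbB, hdB, hcutB⟩ := h2
  have hN' : IsNeighborList S E v [a, c, b, d] := hN.perm (by grind)
  have hN'' : IsNeighborList S E v [a, b, d, c] := hN.perm (by grind)
  have haS := hA haA
  have hbS := hA hbA
  have hcS := hB hcB
  have hdS := (hN.mul_mem d (by simp)).1
  have hA' := h.cut_compl_insert hS hv hN hA hvA haA hbA hcA hdA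
  have hB' := h.cut_compl_insert hS hv hN' hB hvB haB hcB hbB hdB
  by_cases s1 : A.card ≤ 2
  · exact Or.inl (Or.inl (h.mul_of_card_eq_two hS haA hbA (by grind) hA s1 hcutA))
  by_cases s2 : (S \ insert v A).card ≤ 2
  · refine Or.inl (Or.inr (h.mul_of_card_eq_two hS ?_ ?_ (by grind) Finset.sdiff_subset s2
      (by omega)))
    · simp; grind
    · simp; grind
  by_cases s3 : B.card ≤ 2
  · exact Or.inr (Or.inl (h.mul_of_card_eq_two hS haB hcB (by grind) hB s3 hcutB))
  by_cases s4 : (S \ insert v B).card ≤ 2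
  · refine Or.inr (Or.inr (h.mul_of_card_eq_two hS ?_ ?_ (by grind) Finset.sdiff_subset s4
      (by omega)))
    · simp; grind
    · simp; grind
  exfalso
  have u1 := h.uncross hS hv hN hA hB hvA hvB (by grind) (by grind) (by grind) (by grind)
    hcutA hcutB
  have u2 := h.uncross (B := S \ insert v B) hS hv hN'' hA Finset.sdiff_subset hvA (by simp)
    (by grind) (by grind) (by grind) (by grind) hcutA (by omega)
  have e1 : A.card = (A ∩ B).card + (A ∩ (S \ insert v B)).card := by
    rw [← Finset.card_union_of_disjoint]
    · congr 1; grind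
    · rw [Finset.disjoint_left]; grind
  have e2 : B.card = (A ∩ B).card + (S \ insert v (A ∪ (S \ insert v B))).card := by
    rw [← Finset.card_union_of_disjoint]
    · congr 1; grind
    · rw [Finset.disjoint_left]; grind
  have e3 : (S \ insert v A).card
      = (S \ insert v (A ∪ B)).card + (S \ insert v (A ∪ (S \ insert v B))).card := by
    rw [← Finset.card_union_of_disjoint]
    · congr 1; grind
    · rw [Finset.disjoint_left]; grind
  have e4 : (S \ insert v B).card
      = (S \ insert v (A ∪ B)).card + (A ∩ (S \ insert v B)).card := by
    rw [← Finset.card_union_of_disjoint]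
    · congr 1; grind
    · rw [Finset.disjoint_left]; grind
  omega

/-- A neighbor in two triangles at `v` is a twin of `v` if the third pairing is bad. -/
lemma twin_of_bad (h : IsPrimeEdgeList S E) (hS : 4 ≤ S.card) {v a b c d : V} (hv : v ∈ S)
    (hN : IsNeighborList S E v [a, b, c, d]) (hab : edgeMul E a b = 1) (hac : edgeMul E a c = 1)
    (hbad : IsBad S E v a d b c) : edgeMul E a d = 1 := by
  have hnd := hN.nodup
  simp only [List.nodup_cons, List.mem_cons, List.not_mem_nil, or_false, not_or] at hnd
  obtain ⟨A, hA, hvA, haA, hdA, hbA, hcA, hcut⟩ := hbad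
  have haS := hA haA
  have hbS := (hN.mul_mem b (by simp)).1
  have hcS := (hN.mul_mem c (by simp)).1
  by_cases s : A.card ≤ 2
  · exact h.mul_of_card_eq_two hS haA hdA (by grind) hA s hcut
  exfalso
  have h1 := edgeCut_insert E a (A.erase a) (Finset.notMem_erase a A)
  rw [Finset.insert_erase haA, h.deg a haS, h.mul_self hS haS] at h1
  have h2 := edgeMulSet_erase h.mem a
  rw [h.deg a haS, h.mul_self hS haS] at h2
  have hdisj : Disjoint (A.erase a) {v, b, c} := by
    rw [Finset.disjoint_left]; grind
  have h3 : edgeMulSet E a (A.erase a ∪ {v, b, c}) ≤ edgeMulSet E a (S.erase a) :=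
    Finset.sum_le_sum_of_subset (by grind)
  have h4 : edgeMulSet E a (A.erase a ∪ {v, b, c})
      = edgeMulSet E a (A.erase a) + edgeMulSet E a {v, b, c} := Finset.sum_union hdisj
  have hav : edgeMul E a v = 1 := by rw [edgeMul_comm]; exact (hN.mul_mem a (by simp)).2
  have h5 : edgeMulSet E a {v, b, c} = 3 := by
    rw [edgeMulSet, Finset.sum_insert (by grind), Finset.sum_insert (by grind),
      Finset.sum_singleton]
    omega
  have h6 := h.cut (A.erase a) (by grind) (by rw [Finset.card_erase_of_mem haA]; omega) (by
    rw [← Finset.card_pair (a := v) (b := b) (by grind)]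
    exact Finset.card_le_card (by grind))
  omega

/-- `u` is adjacent to `v` and has the same other neighbors. -/
def IsTwin (S : Finset V) (E : List (V × V)) (v u : V) : Prop :=
  u ∈ S ∧ u ≠ v ∧ edgeMul E v u = 1 ∧
    (∀ x ∈ S, x ≠ u → edgeMul E v x = 1 → edgeMul E u x = 1) ∧
    ∀ x ∈ S, x ≠ v → edgeMul E u x = 1 → edgeMul E v x = 1

lemma isTwin_of_neighborList (h : IsPrimeEdgeList S E) (hS : 4 ≤ S.card) {v a b c d : V}
    (hv : v ∈ S)
    (hN : IsNeighborList S E v [a, b, c, d]) (hab : edgeMul E a b = 1) (hac : edgeMul E a c = 1)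
    (had : edgeMul E a d = 1) : IsTwin S E v a := by
  have hnd := hN.nodup
  simp only [List.nodup_cons, List.mem_cons, List.not_mem_nil, or_false, not_or] at hnd
  refine ⟨(hN.mul_mem a (by simp)).1, by grind, (hN.mul_mem a (by simp)).2, ?_, ?_⟩
  · intro x hx hxa hvx
    by_cases hxN : x ∈ [a, b, c, d]
    · simp only [List.mem_cons, List.not_mem_nil, or_false] at hxN
      rcases hxN with rfl | rfl | rfl | rfl
      · exact absurd rfl hxa
      · exact hab
      · exact hac
      · exact had
    · have := hN.mul_notMem x hx hxN; omega
  · intro x hx hxv hax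
    by_cases hxN : x ∈ [a, b, c, d]
    · exact (hN.mul_mem x hxN).2
    simp only [List.mem_cons, List.not_mem_nil, or_false, not_or] at hxN
    exfalso
    have haS := (hN.mul_mem a (by simp)).1
    have hbS := (hN.mul_mem b (by simp)).1
    have hcS := (hN.mul_mem c (by simp)).1
    have hdS := (hN.mul_mem d (by simp)).1
    have hav : edgeMul E a v = 1 := by rw [edgeMul_comm]; exact (hN.mul_mem a (by simp)).2
    have h2 := edgeMulSet_erase h.mem a
    rw [h.deg a haS, h.mul_self hS haS] at h2
    have h3 : edgeMulSet E a {x, v, b, c, d} ≤ edgeMulSet E a (S.erase a) :=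
      Finset.sum_le_sum_of_subset (by grind)
    have h4 : edgeMulSet E a {x, v, b, c, d} = 5 := by
      rw [edgeMulSet, Finset.sum_insert (by grind), Finset.sum_insert (by grind),
        Finset.sum_insert (by grind), Finset.sum_insert (by grind), Finset.sum_singleton]
      omega
    omega

lemma exists_isTwin (h : IsPrimeEdgeList S E) (hS : 4 ≤ S.card) {v a b c d : V} (hv : v ∈ S)
    (hN : IsNeighborList S E v [a, b, c, d]) (h1 : IsBad S E v a b c d)
    (h2 : IsBad S E v a c b d) (h3 : IsBad S E v a d b c) : ∃ u, IsTwin S E v u := by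
  have key : ∀ p q r s : V, [a, b, c, d].Perm [p, q, r, s] → IsBad S E v p s q r →
      edgeMul E p q = 1 → edgeMul E p r = 1 → ∃ u, IsTwin S E v u := by
    intro p q r s hp hbad hpq hpr
    have hN' := hN.perm hp
    exact ⟨p, h.isTwin_of_neighborList hS hv hN' hpq hpr (h.twin_of_bad hS hv hN' hpq hpr hbad)⟩
  have t12 := h.triangle_of_bad hS hv hN h1 h2
  have t13 := h.triangle_of_bad hS hv (hN.perm (show [a, b, c, d].Perm [a, b, d, c] by grind))
    (by obtain ⟨A, h⟩ := h1; exact ⟨A, by tauto⟩) h3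
  have t23 := h.triangle_of_bad hS hv (hN.perm (show [a, b, c, d].Perm [a, c, d, b] by grind))
    (by obtain ⟨A, h⟩ := h2; exact ⟨A, by tauto⟩)
    (by obtain ⟨A, h⟩ := h3; exact ⟨A, by tauto⟩)
  have h1' := IsBad.compl h hS hv hN h1
  have h2' := IsBad.compl h hS hv (hN.perm (show [a, b, c, d].Perm [a, c, b, d] by grind)) h2
  have h3' := IsBad.compl h hS hv (hN.perm (show [a, b, c, d].Perm [a, d, b, c] by grind)) h3
  have bad_swap : ∀ {p q r s : V}, IsBad S E v p q r s → IsBad S E v q p r s := by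
    rintro p q r s ⟨A, h⟩; exact ⟨A, by tauto⟩
  have comm := edgeMul_comm E
  have ka1 := key a b c d (by grind) h3
  have ka2 := key a b d c (by grind) h2
  have ka3 := key a c d b (by grind) h1
  have kb1 := key b a c d (by grind) h2'
  have kb2 := key b a d c (by grind) h3'
  have kb3 := key b c d a (by grind) (bad_swap h1)
  have kc1 := key c a b d (by grind) h1'
  have kc2 := key c a d b (by grind) (bad_swap h3')
  have kc3 := key c b d a (by grind) (bad_swap h2)
  have kd1 := key d a b c (by grind) (bad_swap h1')
  have kd2 := key d a c b (by grind) (bad_swap h2')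
  have kd3 := key d b c a (by grind) (bad_swap h3)
  rw [comm b a] at kb1 kb2
  rw [comm c a] at kc1 kc2
  rw [comm c b] at kc1 kc3
  rw [comm d a] at kd1 kd2
  rw [comm d b] at kd1 kd3
  rw [comm d c] at kd2 kd3
  rw [comm d b] at t23
  rw [comm d c] at t13
  rw [comm c b] at t23
  by_contra hn
  simp only [hn, imp_false] at ka1 ka2 ka3 kb1 kb2 kb3 kc1 kc2 kc3 kd1 kd2 kd3
  clear key h1 h2 h3 h1' h2' h3' bad_swap comm
  rcases t12 with (h | h) | (h | h) <;>
    simp only [h, not_true_eq_false, imp_false, true_imp_iff] at * <;> simp_all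

/-- Four pairwise adjacent vertices are left by only four edges. -/
lemma not_isClique_four (h : IsPrimeEdgeList S E) (hS : 6 ≤ S.card) {a b c d : V}
    (hnd : [a, b, c, d].Nodup) (ha : a ∈ S) (hb : b ∈ S) (hc : c ∈ S) (hd : d ∈ S)
    (hab : edgeMul E a b = 1) (hac : edgeMul E a c = 1) (had : edgeMul E a d = 1)
    (hbc : edgeMul E b c = 1) (hbd : edgeMul E b d = 1) (hcd : edgeMul E c d = 1) : False := by
  simp only [List.nodup_cons, List.mem_cons, List.not_mem_nil, or_false, not_or] at hnd
  have hself : ∀ x ∈ S, edgeMul E x x = 0 := fun x hx => h.mul_self (by omega) hx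
  have e1 := edgeCut_insert E a {b, c, d} (by grind)
  have e2 := edgeCut_insert E b {c, d} (by grind)
  have e3 := edgeCut_pair E (x := c) (y := d) (by grind)
  have m1 : edgeMulSet E a {b, c, d} = 3 := by
    rw [edgeMulSet, Finset.sum_insert (by grind), Finset.sum_insert (by grind),
      Finset.sum_singleton]
    omega
  have m2 : edgeMulSet E b {c, d} = 2 := by
    rw [edgeMulSet, Finset.sum_insert (by grind), Finset.sum_singleton]
    omega
  rw [h.deg a ha, hself a ha, m1] at e1
  rw [h.deg b hb, hself b hb, m2] at e2
  rw [h.deg c hc, h.deg d hd, hself c hc, hself d hd, hcd] at e3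
  have hsub : ({a, b, c, d} : Finset V) ⊆ S := by grind
  have hcard : ({a, b, c, d} : Finset V).card = 4 := by
    rw [Finset.card_insert_of_notMem (by grind), Finset.card_insert_of_notMem (by grind),
      Finset.card_pair (by grind)]
  have := h.cut _ hsub (by omega) (by rw [Finset.card_sdiff_of_subset hsub]; omega)
  omega

omit [DecidableEq V] in
lemma exists_mem_ne_ne {x p q r s : V} (hnd : [x, p, q, r, s].Nodup) (t u : V) :
    ∃ y ∈ [p, q, r, s], y ≠ t ∧ y ≠ u := by
  simp only [List.nodup_cons, List.mem_cons, List.not_mem_nil, or_false, not_or] at hnd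
  by_contra! hh
  have hp := hh p (by simp)
  have hq := hh q (by simp)
  have hr := hh r (by simp)
  by_cases h1 : p = t
  · have h2 := hq (by grind)
    have h3 := hr (by grind)
    grind
  · have h2 := hp h1
    by_cases h3 : q = t
    · have h4 := hr (by grind)
      grind
    · have h4 := hq h3
      grind

lemma exists_not_isTwin (h : IsPrimeEdgeList S E) (hS : 6 ≤ S.card) :
    ∃ v ∈ S, ∀ u, ¬ IsTwin S E v u := by
  by_contra! hcon
  obtain ⟨v, hv⟩ : S.Nonempty := by rw [← Finset.card_pos]; omega
  obtain ⟨u, huS, huv, hvu, htw, htw'⟩ := hcon v hv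
  have comm := edgeMul_comm E
  have hself : ∀ x ∈ S, edgeMul E x x = 0 := fun x hx => h.mul_self (by omega) hx
  -- a common neighbor `x` of `v` and `u`
  obtain ⟨p, q, r, s, hN⟩ := h.exists_neighbors (by omega) hv
  have hnd := hN.nodup
  simp only [List.nodup_cons, List.mem_cons, List.not_mem_nil, or_false, not_or] at hnd
  obtain ⟨x, hx, hvx, hxu⟩ : ∃ x ∈ S, edgeMul E v x = 1 ∧ x ≠ u := by
    by_cases hp : p = u
    · exact ⟨q, (hN.mul_mem q (by simp)).1, (hN.mul_mem q (by simp)).2, by grind⟩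
    · exact ⟨p, (hN.mul_mem p (by simp)).1, (hN.mul_mem p (by simp)).2, hp⟩
  have hux := htw x hx hxu hvx
  have hxv : x ≠ v := by rintro rfl; have := hself x hx; omega
  -- no neighbor of `x` is a third common neighbor
  have hno : ∀ y ∈ S, y ≠ u → edgeMul E v y = 1 → edgeMul E x y ≠ 1 := by
    intro y hy hyu hvy hxy
    have hyv : y ≠ v := by rintro rfl; have := hself y hy; omega
    have hyx : y ≠ x := by rintro rfl; have := hself y hy; omega
    exact h.not_isClique_four hS (a := v) (b := u) (c := x) (d := y)
      (by simp only [List.nodup_cons, List.mem_cons, List.not_mem_nil, or_false, not_or]; grind)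
      hv huS hx hy hvu hvx hvy hux (htw y hy hyu hvy) hxy
  obtain ⟨t, htS, htx, hxt, htwx, -⟩ := hcon x hx
  have hxv1 : edgeMul E x v = 1 := by rw [comm]; exact hvx
  have hxu1 : edgeMul E x u = 1 := by rw [comm]; exact hux
  by_cases htv : t = v
  · subst htv
    obtain ⟨p', q', r', s', hN'⟩ := h.exists_neighbors (by omega) hx
    have hnd' := hN'.nodup
    simp only [List.nodup_cons, List.mem_cons, List.not_mem_nil, or_false, not_or] at hnd'
    obtain ⟨y, hy, hyt, hyu⟩ : ∃ y ∈ [p', q', r', s'], y ≠ t ∧ y ≠ u := by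
      exact exists_mem_ne_ne hN'.nodup _ _
    obtain ⟨hyS, hxy⟩ := hN'.mul_mem y hy
    exact hno y hyS hyu (htwx y hyS hyt hxy) hxy
  · by_cases htu : t = u
    · subst htu
      obtain ⟨p', q', r', s', hN'⟩ := h.exists_neighbors (by omega) hx
      have hnd' := hN'.nodup
      simp only [List.nodup_cons, List.mem_cons, List.not_mem_nil, or_false, not_or] at hnd'
      obtain ⟨y, hy, hyt, hyv⟩ : ∃ y ∈ [p', q', r', s'], y ≠ t ∧ y ≠ v := by
        exact exists_mem_ne_ne hN'.nodup _ _
      obtain ⟨hyS, hxy⟩ := hN'.mul_mem y hy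
      exact hno y hyS hyt (htw' y hyS hyv (htwx y hyS hyt hxy)) hxy
    · have h1 := htwx v hv (Ne.symm htv) hxv1
      exact hno t htS htu (by rw [comm]; exact h1) hxt

/-- At some vertex not all three pairings of the neighbors are bad. -/
lemma exists_not_isBad (h : IsPrimeEdgeList S E) (hS : 6 ≤ S.card) :
    ∃ v ∈ S, ∀ a b c d, IsNeighborList S E v [a, b, c, d] →
      ¬ IsBad S E v a b c d ∨ ¬ IsBad S E v a c b d ∨ ¬ IsBad S E v a d b c := by
  obtain ⟨v, hv, hno⟩ := h.exists_not_isTwin hS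
  refine ⟨v, hv, fun a b c d hN => ?_⟩
  by_contra! hcon
  obtain ⟨u, hu⟩ := h.exists_isTwin (by omega) hv hN hcon.1 hcon.2.1 hcon.2.2
  exact hno u hu

/-- Deleting `v` and joining its neighbors along a pairing that is not bad keeps primality. -/
lemma cut_splitOff (h : IsPrimeEdgeList S E) (hS : 4 ≤ S.card) {v a b c d : V} (hv : v ∈ S)
    (hN : IsNeighborList S E v [a, b, c, d]) (hbad : ¬ IsBad S E v a b c d)
    {E₀ : List (V × V)}
    (hE : ∀ A, edgeCut E A = edgeCut [(v, a), (v, b), (v, c), (v, d)] A + edgeCut E₀ A)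
    (hmem : ∀ p ∈ E₀, p.1 ≠ v ∧ p.2 ≠ v) {A : Finset V} (hA : A ⊆ S.erase v)
    (h2 : 2 ≤ A.card) (h2' : 2 ≤ (S.erase v \ A).card) :
    6 ≤ edgeCut ((a, b) :: (c, d) :: E₀) A := by
  have hnd := hN.nodup
  simp only [List.nodup_cons, List.mem_cons, List.not_mem_nil, or_false, not_or] at hnd
  have haS := (hN.mul_mem a (by simp)).1
  have hbS := (hN.mul_mem b (by simp)).1
  have hcS := (hN.mul_mem c (by simp)).1
  have hdS := (hN.mul_mem d (by simp)).1
  have hvA : v ∉ A := fun hh => by simpa using hA hh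
  have hAS : A ⊆ S := hA.trans (Finset.erase_subset _ _)
  have hk : (S.erase v \ A).card ≤ (S \ A).card :=
    Finset.card_le_card (Finset.sdiff_subset_sdiff (Finset.erase_subset _ _) le_rfl)
  have c1 := h.cut A hAS h2 (by omega)
  have c2 := h.cut (insert v A) (by grind)
    (by rw [Finset.card_insert_of_notMem hvA]; omega)
    (by rw [show S \ insert v A = S.erase v \ A by grind]; exact h2')
  have ev : Even (edgeCut E A) := edgeCut_even fun x hx => by
    rw [h.deg x (hAS hx)]; exact ⟨2, rfl⟩
  have nb1 : a ∈ A → b ∈ A → c ∉ A → d ∉ A → 8 ≤ edgeCut E A := by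
    intro h1 h2 h3 h4
    by_contra hlt
    exact hbad ⟨A, hAS, hvA, h1, h2, h3, h4, by obtain ⟨k, hk⟩ := ev; omega⟩
  have nb2 : c ∈ A → d ∈ A → a ∉ A → b ∉ A → 8 ≤ edgeCut E A := by
    intro h1 h2 h3 h4
    by_contra hlt
    have hN' : IsNeighborList S E v [c, d, a, b] := hN.perm (by grind)
    refine hbad (IsBad.compl h hS hv hN'
      ⟨A, hAS, hvA, h1, h2, h3, h4, by obtain ⟨k, hk⟩ := ev; omega⟩)
  rw [hE] at c1 c2 nb1 nb2
  have e0 : edgeCut E₀ (insert v A) = edgeCut E₀ A := by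
    unfold edgeCut
    congr 1
    apply List.map_congr_left
    intro p hp
    have := hmem p hp
    simp [this.1, this.2]
  rw [e0] at c2
  simp only [edgeCut_cons, edgeCut_nil, hvA, Finset.mem_insert, true_or, true_iff, false_iff]
    at c1 c2 nb1 nb2 ⊢
  have : a ≠ v := by grind
  have : b ≠ v := by grind
  have : c ≠ v := by grind
  have : d ≠ v := by grind
  by_cases ha : a ∈ A <;> by_cases hb : b ∈ A <;> by_cases hc : c ∈ A <;> by_cases hd : d ∈ A <;>
    simp [*] at c1 c2 nb1 nb2 ⊢ <;> omega

end IsPrimeEdgeList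

end Chain

section Words

variable {V : Type*} [DecidableEq V]

/-- The pair of the last letter of `l` and the first letter of `m`. -/
def joint (l m : List V) : List (V × V) :=
  match l.getLast?, m.head? with
  | some a, some b => [(a, b)]
  | _, _ => []

/-- The pairs of consecutive letters of a word. -/
def linEdges : List V → List (V × V)
  | [] => []
  | x :: l => joint [x] l ++ linEdges l

/-- The pairs of cyclically consecutive letters of a word. -/
def cycEdges (l : List V) : List (V × V) := linEdges l ++ joint l l

lemma edgeCut_append (E F : List (V × V)) (P : Finset V) :
    edgeCut (E ++ F) P = edgeCut E P + edgeCut F P := by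
  simp [edgeCut]

lemma edgeMul_append (E F : List (V × V)) (x y : V) :
    edgeMul (E ++ F) x y = edgeMul E x y + edgeMul F x y := by
  simp [edgeMul]

lemma edgeDeg_append (E F : List (V × V)) (x : V) :
    edgeDeg (E ++ F) x = edgeDeg E x + edgeDeg F x := by
  simp [edgeDeg]

omit [DecidableEq V] in
@[simp] lemma joint_nil_left (m : List V) : joint [] m = [] := rfl

omit [DecidableEq V] in
@[simp] lemma joint_nil_right (l : List V) : joint l [] = [] := by
  unfold joint; cases l.getLast? <;> rfl

omit [DecidableEq V] in
@[simp] lemma joint_concat_cons (l m : List V) (a b : V) :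
    joint (l ++ [a]) (b :: m) = [(a, b)] := by
  simp [joint]

omit [DecidableEq V] in
lemma joint_append_left {l : List V} (hl : l ≠ []) (k m : List V) :
    joint (k ++ l) m = joint l m := by
  simp [joint, List.getLast?_append_of_ne_nil _ hl]

omit [DecidableEq V] in
lemma joint_append_right {m : List V} (hm : m ≠ []) (l k : List V) :
    joint l (m ++ k) = joint l m := by
  simp [joint, List.head?_append_of_ne_nil _ hm]

omit [DecidableEq V] in
lemma linEdges_append (l m : List V) :
    linEdges (l ++ m) = linEdges l ++ joint l m ++ linEdges m := by
  induction l with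
  | nil => simp [linEdges]
  | cons x l ih =>
    rcases List.eq_nil_or_concat l with rfl | ⟨l', y, rfl⟩
    · simp [linEdges]
    · have h1 : l' ++ [y] ≠ [] := by simp
      simp only [List.concat_eq_append] at ih ⊢
      rw [List.cons_append, linEdges, ih, linEdges, joint_append_right h1,
        show x :: (l' ++ [y]) = [x] ++ (l' ++ [y]) from rfl, joint_append_left h1]
      simp

lemma edgeCut_joint_comm (l m : List V) (P : Finset V) :
    edgeCut (joint m.reverse l.reverse) P = edgeCut (joint l m) P := by
  simp only [joint, List.getLast?_reverse, List.head?_reverse]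
  cases l.getLast? <;> cases m.head? <;> simp [iff_comm]

lemma edgeCut_linEdges_reverse (l : List V) (P : Finset V) :
    edgeCut (linEdges l.reverse) P = edgeCut (linEdges l) P := by
  induction l with
  | nil => rfl
  | cons x l ih =>
    have := edgeCut_joint_comm [x] l P
    rw [List.reverse_cons, linEdges_append, linEdges]
    simp only [edgeCut_append, ih]
    simp only [List.reverse_cons, List.reverse_nil, List.nil_append] at this
    rw [this]
    simp [linEdges, edgeCut_append, add_comm]

lemma edgeCut_cycEdges_reverse (l : List V) (P : Finset V) :
    edgeCut (cycEdges l.reverse) P = edgeCut (cycEdges l) P := by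
  rw [cycEdges, cycEdges, edgeCut_append, edgeCut_append, edgeCut_linEdges_reverse,
    edgeCut_joint_comm]

omit [DecidableEq V] in
lemma cycEdges_append {l m : List V} (hl : l ≠ []) (hm : m ≠ []) :
    cycEdges (l ++ m) = linEdges l ++ joint l m ++ linEdges m ++ joint m l := by
  rw [cycEdges, linEdges_append, joint_append_left hm, joint_append_right hl]

omit [DecidableEq V] in
lemma exists_append_of_isRotated {l l' : List V} (h : l ~r l') :
    ∃ X Y, l = X ++ Y ∧ l' = Y ++ X := by
  obtain ⟨n, hn, rfl⟩ := List.isRotated_iff_mod.1 h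
  exact ⟨l.take n, l.drop n, (List.take_append_drop n l).symm,
    List.rotate_eq_drop_append_take hn⟩

lemma edgeCut_cycEdges_isRotated {l l' : List V} (h : l ~r l') (P : Finset V) :
    edgeCut (cycEdges l) P = edgeCut (cycEdges l') P := by
  obtain ⟨X, Y, rfl, rfl⟩ := exists_append_of_isRotated h
  by_cases hX : X = []
  · simp [hX]
  by_cases hY : Y = []
  · simp [hY]
  rw [cycEdges_append hX hY, cycEdges_append hY hX]
  simp only [edgeCut_append]
  ring

lemma edgeDeg_joint {l m : List V} (hl : l ≠ []) (hm : m ≠ []) (x : V) :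
    edgeDeg (joint l m) x
      = (if l.getLast? = some x then 1 else 0) + (if m.head? = some x then 1 else 0) := by
  simp only [joint]
  rw [List.getLast?_eq_some_getLast hl, List.head?_eq_some_head hm]
  simp

lemma edgeDeg_linEdges (l : List V) (x : V) :
    edgeDeg (linEdges l) x + (if l.head? = some x then 1 else 0)
      + (if l.getLast? = some x then 1 else 0) = 2 * l.count x := by
  induction l with
  | nil => simp [linEdges]
  | cons a l ih =>
    by_cases hl : l = []
    · subst hl
      by_cases h : a = x <;> simp [linEdges, h]
    · rw [linEdges, edgeDeg_append, edgeDeg_joint (by simp) hl, List.count_cons,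
        show a :: l = [a] ++ l from rfl, List.getLast?_append_of_ne_nil _ hl]
      by_cases h : a = x <;> simp [h] <;> omega

lemma edgeDeg_cycEdges (l : List V) (x : V) : edgeDeg (cycEdges l) x = 2 * l.count x := by
  by_cases hl : l = []
  · subst hl; simp [cycEdges, linEdges]
  · rw [cycEdges, edgeDeg_append, edgeDeg_joint hl hl]
    have := edgeDeg_linEdges l x
    omega

omit [DecidableEq V] in
lemma mem_of_mem_joint {l m : List V} {p : V × V} (h : p ∈ joint l m) : p.1 ∈ l ∧ p.2 ∈ m := by
  unfold joint at h
  split at h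
  · rename_i a b ha hb
    simp only [List.mem_singleton] at h
    subst h
    exact ⟨List.mem_of_getLast? ha, List.mem_of_mem_head? hb⟩
  · simp at h

omit [DecidableEq V] in
lemma mem_of_mem_linEdges {l : List V} {p : V × V} (h : p ∈ linEdges l) : p.1 ∈ l ∧ p.2 ∈ l := by
  induction l with
  | nil => simp [linEdges] at h
  | cons x l ih =>
    rw [linEdges, List.mem_append] at h
    rcases h with h | h
    · have := mem_of_mem_joint h
      simp_all
    · have := ih h
      simp [this]

omit [DecidableEq V] in
lemma mem_of_mem_cycEdges {l : List V} {p : V × V} (h : p ∈ cycEdges l) : p.1 ∈ l ∧ p.2 ∈ l := by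
  rw [cycEdges, List.mem_append] at h
  exact h.elim mem_of_mem_linEdges mem_of_mem_joint

/-- Every element of `S` occurs twice in `l`, and nothing else occurs. -/
structure IsDoubleWord (S : Finset V) (l : List V) : Prop where
  count : ∀ v ∈ S, l.count v = 2
  mem : ∀ v ∈ l, v ∈ S

/-- The cyclic word `l` is a prime Eulerian circuit. -/
structure IsPrimeWord (S : Finset V) (l : List V) : Prop extends IsDoubleWord S l where
  cut : ∀ A ⊆ S, 2 ≤ A.card → 2 ≤ (S \ A).card → 6 ≤ edgeCut (cycEdges l) A

lemma IsPrimeWord.isPrimeEdgeList {S : Finset V} {l : List V} (h : IsPrimeWord S l) :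
    IsPrimeEdgeList S (cycEdges l) where
  mem p hp := by
    have := mem_of_mem_cycEdges hp
    exact ⟨h.mem _ this.1, h.mem _ this.2⟩
  deg x hx := by rw [edgeDeg_cycEdges, h.count x hx]
  cut := h.cut

/-- The occurrences of `u` and `v` alternate in `l`. -/
def Alt (l : List V) (u v : V) : Prop :=
  l.filter (fun x => x = u ∨ x = v) = [u, v, u, v] ∨
    l.filter (fun x => x = u ∨ x = v) = [v, u, v, u]

/-- `l` and `l'` have the same alternating pairs. -/
def SameAlt (l l' : List V) : Prop := ∀ u v, u ≠ v → (Alt l u v ↔ Alt l' u v)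

/-- `l` and `l'` agree up to rotation and reversal. -/
def SameCircuit (l l' : List V) : Prop := l ~r l' ∨ l.reverse ~r l'

lemma IsDoubleWord.perm {S : Finset V} {l l' : List V} (h : IsDoubleWord S l) (hp : l.Perm l') :
    IsDoubleWord S l' :=
  ⟨fun v hv => by rw [← hp.count_eq]; exact h.count v hv,
    fun v hv => h.mem v (hp.mem_iff.2 hv)⟩

lemma IsPrimeWord.of_cut {S : Finset V} {l l' : List V} (h : IsPrimeWord S l) (hp : l.Perm l')
    (hc : ∀ P, edgeCut (cycEdges l) P = edgeCut (cycEdges l') P) : IsPrimeWord S l' :=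
  ⟨h.toIsDoubleWord.perm hp, fun A hA h1 h2 => by rw [← hc]; exact h.cut A hA h1 h2⟩

lemma IsPrimeWord.isRotated {S : Finset V} {l l' : List V} (h : IsPrimeWord S l) (hr : l ~r l') :
    IsPrimeWord S l' :=
  h.of_cut hr.perm (edgeCut_cycEdges_isRotated hr)

lemma edgeCut_linEdges_reverse_right {l m : List V} (v : V) (P : Finset V) :
    edgeCut (cycEdges (v :: l ++ v :: m.reverse)) P
      = edgeCut (cycEdges (v :: l ++ v :: m)) P := by
  have key : ∀ k : List V, edgeCut (cycEdges (v :: l ++ v :: k)) P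
      = edgeCut (linEdges ([v] ++ l ++ [v])) P + edgeCut (linEdges ([v] ++ k ++ [v])) P := by
    intro k
    have e : cycEdges (v :: l ++ v :: k)
        = linEdges (v :: l) ++ joint (v :: l) [v] ++ linEdges (v :: k) ++ joint (v :: k) [v] := by
      rw [cycEdges_append (by simp) (by simp)]
      rfl
    rw [e, linEdges_append ([v] ++ l) [v], linEdges_append ([v] ++ k) [v]]
    simp only [edgeCut_append, List.singleton_append]
    simp [linEdges, add_assoc]
  rw [key, key]
  congr 1
  rw [← edgeCut_linEdges_reverse ([v] ++ m ++ [v])]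
  simp

lemma IsPrimeWord.localCompl {S : Finset V} {v : V} {A B : List V}
    (h : IsPrimeWord S (v :: A ++ v :: B)) : IsPrimeWord S (v :: A ++ v :: B.reverse) :=
  h.of_cut (((List.reverse_perm B).symm.cons v).append_left _)
    fun P => (edgeCut_linEdges_reverse_right v P).symm

lemma Alt.isRotated {l l' : List V} {u v : V} (h : Alt l u v) (hr : l ~r l') : Alt l' u v := by
  obtain ⟨X, Y, rfl, rfl⟩ := exists_append_of_isRotated hr
  unfold Alt at h ⊢
  rw [List.filter_append] at h ⊢
  generalize X.filter _ = x at *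
  generalize Y.filter _ = y at *
  simp only [List.append_eq_cons_iff, List.cons_eq_append_iff, List.nil_eq_append_iff] at h
  rcases h with h | h
  · rcases h with ⟨rfl, rfl⟩ | ⟨a, rfl, h⟩
    · simp
    rcases h with ⟨rfl, rfl⟩ | ⟨a, rfl, h⟩
    · simp
    rcases h with ⟨rfl, rfl⟩ | ⟨a, rfl, h⟩
    · simp
    rcases h with ⟨rfl, rfl⟩ | ⟨a, rfl, h⟩
    · simp
    · simp [h]
  · rcases h with ⟨rfl, rfl⟩ | ⟨a, rfl, h⟩
    · simp
    rcases h with ⟨rfl, rfl⟩ | ⟨a, rfl, h⟩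
    · simp
    rcases h with ⟨rfl, rfl⟩ | ⟨a, rfl, h⟩
    · simp
    rcases h with ⟨rfl, rfl⟩ | ⟨a, rfl, h⟩
    · simp
    · simp [h]

lemma alt_reverse {l : List V} {u v : V} : Alt l.reverse u v ↔ Alt l u v := by
  unfold Alt
  rw [List.filter_reverse, List.reverse_eq_iff, List.reverse_eq_iff]
  simp [or_comm]

lemma sameAlt_of_isRotated {l l' : List V} (hr : l ~r l') : SameAlt l l' :=
  fun _ _ _ => ⟨fun h => h.isRotated hr, fun h => h.isRotated hr.symm⟩

lemma SameAlt.symm {l l' : List V} (h : SameAlt l l') : SameAlt l' l :=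
  fun u v huv => (h u v huv).symm

lemma SameAlt.trans {l l' l'' : List V} (h : SameAlt l l') (h' : SameAlt l' l'') : SameAlt l l'' :=
  fun u v huv => (h u v huv).trans (h' u v huv)

omit [DecidableEq V] in
lemma SameCircuit.symm {l l' : List V} (h : SameCircuit l l') : SameCircuit l' l := by
  rcases h with h | h
  · exact .inl h.symm
  · exact .inr (by simpa using h.symm.reverse)

omit [DecidableEq V] in
lemma SameCircuit.trans {l l' l'' : List V} (h : SameCircuit l l') (h' : SameCircuit l' l'') :
    SameCircuit l l'' := by
  rcases h with h | h <;> rcases h' with h' | h'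
  · exact .inl (h.trans h')
  · exact .inr (h.reverse.trans h')
  · exact .inr (h.trans h')
  · exact .inl (by simpa using h.reverse.trans h')

end Words

section Alternation

variable {V : Type*} [DecidableEq V]

lemma alt_comm {l : List V} {u v : V} : Alt l u v ↔ Alt l v u := by
  unfold Alt
  simp only [or_comm (a := _ = u)]
  rw [or_comm]

lemma filter_or_of_notMem {l : List V} {v y : V} (hv : v ∉ l) :
    l.filter (fun x => x = v ∨ x = y) = List.replicate (l.count y) y := by
  rw [← List.filter_eq y]
  refine List.filter_congr fun x hx => ?_
  have : x ≠ v := by rintro rfl; exact hv hx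
  simp [this, eq_comm]

lemma alt_cons_append_cons {A B : List V} {v y : V} (hA : v ∉ A) (hB : v ∉ B) (hy : y ≠ v)
    (hc : A.count y + B.count y = 2) : Alt (v :: A ++ v :: B) v y ↔ A.count y = 1 := by
  unfold Alt
  rw [List.filter_append, List.filter_cons_of_pos (by simp), List.filter_cons_of_pos (by simp),
    filter_or_of_notMem hA, filter_or_of_notMem hB]
  obtain h | h | h : A.count y = 0 ∨ A.count y = 1 ∨ A.count y = 2 := by omega
  · rw [h, show B.count y = 2 by omega]
    simp [List.replicate, hy, hy.symm]
  · rw [h, show B.count y = 1 by omega]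
    simp [List.replicate]
  · rw [h, show B.count y = 0 by omega]
    simp [List.replicate, hy, hy.symm]

omit [DecidableEq V] in
lemma exists_map_bool {l : List V} {x y : V} (h : ∀ z ∈ l, z = x ∨ z = y) :
    ∃ b : List Bool, l = b.map fun t => cond t x y := by
  induction l with
  | nil => exact ⟨[], rfl⟩
  | cons a l ih =>
    obtain ⟨b, hb⟩ := ih fun z hz => h z (List.mem_cons_of_mem _ hz)
    rcases h a List.mem_cons_self with rfl | rfl
    · exact ⟨true :: b, by simp [← hb]⟩
    · exact ⟨false :: b, by simp [← hb]⟩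

set_option synthInstance.maxSize 1000 in
set_option synthInstance.maxHeartbeats 200000 in
lemma alt_append_reverse_bool (a b : List Bool) (ht : a.count true + b.count true = 2)
    (hf : a.count false + b.count false = 2) :
    ((a ++ b.reverse = [true, false, true, false] ∨ a ++ b.reverse = [false, true, false, true]) ↔
      ¬ ((a ++ b = [true, false, true, false] ∨ a ++ b = [false, true, false, true]) ↔
        (a.count true = 1 ∧ a.count false = 1))) := by
  have hl : (a ++ b).length = 4 := by
    have h1 := List.count_true_add_count_false (l := a)
    have h2 := List.count_true_add_count_false (l := b)
    rw [List.length_append]; omega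
  obtain ⟨p, q, r, s, hs⟩ := List.length_eq_four.1 hl
  have key : ∀ p q r s : Bool, ∀ k < 5,
      [p, q, r, s].count true = 2 → [p, q, r, s].count false = 2 →
      (([p, q, r, s].take k ++ ([p, q, r, s].drop k).reverse = [true, false, true, false] ∨
        [p, q, r, s].take k ++ ([p, q, r, s].drop k).reverse = [false, true, false, true]) ↔
      ¬ (([p, q, r, s] = [true, false, true, false] ∨
          [p, q, r, s] = [false, true, false, true]) ↔
        (([p, q, r, s].take k).count true = 1 ∧ ([p, q, r, s].take k).count false = 1))) := by
    decide +kernel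
  have := key p q r s a.length (by rw [List.length_append] at hl; omega)
    (by rw [← hs]; simpa using ht) (by rw [← hs]; simpa using hf)
  rw [← hs] at this
  simpa only [List.take_left, List.drop_left] using this

lemma alt_append_reverse {A B : List V} {x y : V} (hxy : x ≠ y)
    (hx : A.count x + B.count x = 2) (hy : A.count y + B.count y = 2) :
    Alt (A ++ B.reverse) x y ↔ ¬ (Alt (A ++ B) x y ↔ (A.count x = 1 ∧ A.count y = 1)) := by
  have hinj : Function.Injective fun t : Bool => cond t x y := by
    intro s t; cases s <;> cases t <;> simp [hxy, hxy.symm]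
  have hmem : ∀ l : List V, ∀ z ∈ l.filter (fun t => t = x ∨ t = y), z = x ∨ z = y := by
    intro l z hz; simpa using (List.mem_filter.1 hz).2
  have hcx : ∀ l : List V, (l.filter (fun t => t = x ∨ t = y)).count x = l.count x :=
    fun l => List.count_filter (by simp)
  have hcy : ∀ l : List V, (l.filter (fun t => t = x ∨ t = y)).count y = l.count y :=
    fun l => List.count_filter (by simp)
  obtain ⟨a, ha⟩ := exists_map_bool (hmem A)
  obtain ⟨b, hb⟩ := exists_map_bool (hmem B)
  have htx : ∀ s : List Bool, (s.map fun t => cond t x y).count x = s.count true :=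
    fun s => List.count_map_of_injective s _ hinj true
  have hty : ∀ s : List Bool, (s.map fun t => cond t x y).count y = s.count false :=
    fun s => List.count_map_of_injective s _ hinj false
  have e1 : ∀ s : List Bool, (s.map (fun t => cond t x y) = [x, y, x, y]) ↔
      s = [true, false, true, false] := fun s => by
    rw [← hinj.list_map.eq_iff (a := s)]; simp
  have e2 : ∀ s : List Bool, (s.map (fun t => cond t x y) = [y, x, y, x]) ↔
      s = [false, true, false, true] := fun s => by
    rw [← hinj.list_map.eq_iff (a := s)]; simp
  unfold Alt
  rw [List.filter_append, List.filter_append, List.filter_reverse]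
  rw [← hcx A, ← hcy A]
  rw [← hcx A, ← hcx B] at hx
  rw [← hcy A, ← hcy B] at hy
  rw [ha, hb] at hx hy ⊢
  rw [htx, htx] at hx
  rw [hty, hty] at hy
  rw [htx, hty, ← List.map_reverse, ← List.map_append, ← List.map_append, e1, e2, e1, e2]
  exact alt_append_reverse_bool a b hx hy

end Alternation

section Circuits

variable {V : Type*} [DecidableEq V]

omit [DecidableEq V] in
lemma eq_of_append_cons_eq {v : V} {A B A' B' : List V} (hA : v ∉ A) (hA' : v ∉ A')
    (h : A ++ v :: B = A' ++ v :: B') : A = A' ∧ B = B' := by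
  induction A generalizing A' with
  | nil =>
    cases A' with
    | nil => simpa using h
    | cons b A' => simp at h hA'; tauto
  | cons a A ih =>
    cases A' with
    | nil => simp at h hA; tauto
    | cons b A' =>
      simp only [List.cons_append, List.cons.injEq] at h
      have := ih (fun hh => hA (List.mem_cons_of_mem _ hh))
        (fun hh => hA' (List.mem_cons_of_mem _ hh)) h.2
      simp [h.1, this]

omit [DecidableEq V] in
lemma isRotated_swap (v : V) (A B : List V) : (v :: A ++ v :: B) ~r (v :: B ++ v :: A) :=
  List.isRotated_append

omit [DecidableEq V] in
lemma sections_eq_of_isRotated {v : V} {A B A' B' : List V} (hA : v ∉ A) (hB : v ∉ B)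
    (hA' : v ∉ A') (h : (v :: A ++ v :: B) ~r (v :: A' ++ v :: B')) :
    (A = A' ∧ B = B') ∨ (A = B' ∧ B = A') := by
  obtain ⟨X, Y, h1, h2⟩ := exists_append_of_isRotated h
  cases X with
  | nil =>
    left
    rw [List.nil_append] at h1
    rw [List.append_nil, ← h1] at h2
    have := eq_of_append_cons_eq hA' hA (List.cons_injective h2)
    exact ⟨this.1.symm, this.2.symm⟩
  | cons x X =>
    cases Y with
    | nil =>
      left
      rw [List.append_nil] at h1
      rw [List.nil_append, ← h1] at h2
      have := eq_of_append_cons_eq hA' hA (List.cons_injective h2)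
      exact ⟨this.1.symm, this.2.symm⟩
    | cons y Y =>
      right
      simp only [List.cons_append, List.cons.injEq] at h1 h2
      obtain ⟨rfl, h1⟩ := h1
      obtain ⟨rfl, h2⟩ := h2
      have hX : v ∉ X := by
        intro hX
        have hXc : [v, v].Sublist (A ++ v :: B) := by
          rw [h1]
          exact (List.singleton_sublist.2 hX).append (List.singleton_sublist.2 (by simp))
        obtain ⟨k, m, hkm, hk, hm⟩ := List.sublist_append_iff.1 hXc
        cases k with
        | nil =>
          rw [List.nil_append] at hkm
          rw [← hkm] at hm
          have := hm
          rw [List.cons_sublist_cons, List.singleton_sublist] at this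
          exact hB this
        | cons a k =>
          simp only [List.cons_append, List.cons.injEq] at hkm
          exact hA (hkm.1 ▸ hk.subset (by simp))
      have hY : v ∉ Y := by
        intro hY
        have e := eq_of_append_cons_eq hA hX h1
        exact hB (e.2 ▸ hY)
      have e1 := eq_of_append_cons_eq hA hX h1
      have e2 := eq_of_append_cons_eq hA' hY h2
      exact ⟨e1.1.trans e2.2.symm, e1.2.trans e2.1.symm⟩

lemma exists_sections {v : V} {l : List V} (h : l.count v = 2) :
    ∃ A B, l ~r (v :: A ++ v :: B) ∧ v ∉ A ∧ v ∉ B := by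
  have hv : v ∈ l := List.count_pos_iff.1 (by omega)
  obtain ⟨X, Y, rfl, hX⟩ := List.eq_append_cons_of_mem hv
  have hc : Y.count v = 1 := by
    rw [List.count_append, List.count_cons_self, List.count_eq_zero_of_not_mem hX] at h
    omega
  obtain ⟨A, B, rfl, hA⟩ := List.eq_append_cons_of_mem (List.count_pos_iff.1 (by omega : 0 < Y.count v))
  have hB : v ∉ B := by
    rw [List.count_append, List.count_cons_self] at hc
    exact List.count_eq_zero.1 (by omega)
  refine ⟨A, B ++ X, ?_, hA, by simp [hB, hX]⟩
  have := List.isRotated_append (l := X) (l' := v :: (A ++ v :: B))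
  simpa using this

/-- The word `l` is determined by its alternating pairs. -/
def IsRigid (S : Finset V) (l : List V) : Prop :=
  ∀ l', IsDoubleWord S l' → SameAlt l l' → SameCircuit l l'

lemma IsRigid.of_sameCircuit {S : Finset V} {l m : List V} (h : IsRigid S l)
    (hs : SameAlt l m) (hr : SameCircuit l m) : IsRigid S m :=
  fun l' hl' ha => hr.symm.trans (h l' hl' (hs.trans ha))

lemma IsRigid.isRotated {S : Finset V} {l m : List V} (h : IsRigid S l) (hr : l ~r m) :
    IsRigid S m :=
  h.of_sameCircuit (sameAlt_of_isRotated hr) (.inl hr)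

lemma IsDoubleWord.count_sections {S : Finset V} {v y : V} {A B : List V}
    (h : IsDoubleWord S (v :: A ++ v :: B)) (hy : y ≠ v) (hyS : y ∈ S) :
    A.count y + B.count y = 2 := by
  have := h.count y hyS
  simpa [List.count_cons, hy.symm] using this

lemma Alt.mem {l : List V} {u v : V} (h : Alt l u v) : u ∈ l ∧ v ∈ l := by
  have key : u ∈ l.filter (fun x => x = u ∨ x = v) ∧ v ∈ l.filter (fun x => x = u ∨ x = v) := by
    rcases h with h | h <;> rw [h] <;> simp
  exact ⟨(List.mem_filter.1 key.1).1, (List.mem_filter.1 key.2).1⟩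

lemma sameAlt_iff {S : Finset V} {l l' : List V} (h : IsDoubleWord S l) (h' : IsDoubleWord S l') :
    SameAlt l l' ↔ ∀ u ∈ S, ∀ v ∈ S, u ≠ v → (Alt l u v ↔ Alt l' u v) := by
  refine ⟨fun H u _ v _ huv => H u v huv, fun H u v huv => ?_⟩
  by_cases hu : u ∈ S ∧ v ∈ S
  · exact H u hu.1 v hu.2 huv
  · refine iff_of_false (fun hh => hu ?_) (fun hh => hu ?_)
    · exact ⟨h.mem _ hh.mem.1, h.mem _ hh.mem.2⟩
    · exact ⟨h'.mem _ hh.mem.1, h'.mem _ hh.mem.2⟩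

lemma IsDoubleWord.localCompl {S : Finset V} {v : V} {A B : List V}
    (h : IsDoubleWord S (v :: A ++ v :: B)) : IsDoubleWord S (v :: A ++ v :: B.reverse) :=
  h.perm (((List.reverse_perm B).symm.cons v).append_left _)

lemma alt_del {A B : List V} {v x y : V} (hx : x ≠ v) (hy : y ≠ v) :
    Alt (v :: A ++ v :: B) x y ↔ Alt (A ++ B) x y := by
  unfold Alt
  rw [List.filter_append, List.filter_cons_of_neg (by simp [hx.symm, hy.symm]),
    List.filter_cons_of_neg (by simp [hx.symm, hy.symm]), ← List.filter_append]

lemma SameAlt.localCompl {S : Finset V} {v : V} {A B A' B' : List V}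
    (h : IsDoubleWord S (v :: A ++ v :: B)) (h' : IsDoubleWord S (v :: A' ++ v :: B'))
    (hA : v ∉ A) (hB : v ∉ B) (hA' : v ∉ A') (hB' : v ∉ B')
    (hs : SameAlt (v :: A ++ v :: B) (v :: A' ++ v :: B')) :
    SameAlt (v :: A ++ v :: B.reverse) (v :: A' ++ v :: B'.reverse) := by
  have hcount : ∀ y ∈ S, y ≠ v → (A.count y = 1 ↔ A'.count y = 1) := by
    intro y hyS hy
    rw [← alt_cons_append_cons hA hB hy (h.count_sections hy hyS),
      ← alt_cons_append_cons hA' hB' hy (h'.count_sections hy hyS)]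
    exact hs v y hy.symm
  have hv : ∀ y ∈ S, y ≠ v →
      (Alt (v :: A ++ v :: B.reverse) v y ↔ Alt (v :: A' ++ v :: B'.reverse) v y) := by
    intro y hyS hy
    rw [alt_cons_append_cons hA (by simpa using hB) hy
        (by rw [List.count_reverse]; exact h.count_sections hy hyS),
      alt_cons_append_cons hA' (by simpa using hB') hy
        (by rw [List.count_reverse]; exact h'.count_sections hy hyS)]
    exact hcount y hyS hy
  rw [sameAlt_iff h.localCompl h'.localCompl]
  intro x hxS y hyS hxy
  by_cases hx : x = v
  · subst hx; exact hv y hyS hxy.symm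
  by_cases hy : y = v
  · subst hy; rw [alt_comm, alt_comm (l := y :: A' ++ _)]; exact hv x hxS hxy
  have := hs x y hxy
  rw [alt_del hx hy, alt_del hx hy] at this ⊢
  rw [alt_append_reverse hxy (h.count_sections hx hxS) (h.count_sections hy hyS),
    alt_append_reverse hxy (h'.count_sections hx hxS) (h'.count_sections hy hyS), this,
    hcount x hxS hx, hcount y hyS hy]

omit [DecidableEq V] in
lemma reverse_sections_isRotated (v : V) (A B : List V) :
    (v :: A ++ v :: B).reverse ~r (v :: A.reverse ++ v :: B.reverse) := by
  have h := List.isRotated_append (l := B.reverse ++ v :: A.reverse) (l' := [v])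
  refine List.IsRotated.trans ?_ (isRotated_swap _ _ _)
  simpa using h

lemma IsRigid.of_localCompl {S : Finset V} {v : V} {A B : List V}
    (h : IsDoubleWord S (v :: A ++ v :: B)) (hA : v ∉ A) (hB : v ∉ B)
    (hr : IsRigid S (v :: A ++ v :: B.reverse)) : IsRigid S (v :: A ++ v :: B) := by
  intro l' hl' ha
  obtain ⟨A', B', hr', hA', hB'⟩ := exists_sections (hl'.count v (h.mem v (by simp)))
  have hl'' := hl'.perm hr'.perm
  have ha' := ha.trans (sameAlt_of_isRotated hr')
  refine SameCircuit.trans ?_ (.inl hr'.symm)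
  rcases hr _ hl''.localCompl (ha'.localCompl h hl'' hA hB hA' hB') with hh | hh
  · rcases sections_eq_of_isRotated hA (by simpa using hB) hA' hh with ⟨rfl, h2⟩ | ⟨rfl, rfl⟩
    · rw [List.reverse_injective h2]; exact .inl (List.IsRotated.refl _)
    · right
      have := (reverse_sections_isRotated v B'.reverse B).trans (isRotated_swap _ _ _)
      simpa using this
  · have hh := (reverse_sections_isRotated v A B.reverse).symm.trans hh
    rw [List.reverse_reverse] at hh
    rcases sections_eq_of_isRotated (by simpa using hA) hB hA' hh with ⟨rfl, rfl⟩ | ⟨h1, rfl⟩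
    · right
      have := reverse_sections_isRotated v A B'.reverse
      simpa using this
    · rw [List.reverse_injective h1]
      exact .inl (isRotated_swap _ _ _)

/-- If `P` and `P ∪ {v}` meet the cut condition with small cuts, then `P` is trivial. -/
lemma IsPrimeWord.eq_empty_or_of_cut_le {S P : Finset V} {l : List V} {v : V}
    (h : IsPrimeWord S l) (hS : 4 ≤ S.card) (hv : v ∈ S) (hP : P ⊆ S) (hvP : v ∉ P)
    (h1 : edgeCut (cycEdges l) P ≤ 4) (h2 : edgeCut (cycEdges l) (insert v P) ≤ 4) :
    P = ∅ ∨ P = S.erase v := by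
  have c1 : P.card ≤ 1 ∨ (S \ P).card ≤ 1 := by
    by_contra! hcon
    have := h.cut P hP hcon.1 hcon.2
    omega
  have hP' : insert v P ⊆ S := Finset.insert_subset hv hP
  have c2 : (insert v P).card ≤ 1 ∨ (S \ insert v P).card ≤ 1 := by
    by_contra! hcon
    have := h.cut _ hP' hcon.1 hcon.2
    omega
  rw [Finset.card_sdiff_of_subset hP] at c1
  rw [Finset.card_sdiff_of_subset hP', Finset.card_insert_of_notMem hvP] at c2
  have := Finset.card_le_card hP
  have := Finset.card_le_card hP'
  rw [Finset.card_insert_of_notMem hvP] at this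
  by_cases h0 : P.card = 0
  · exact .inl (Finset.card_eq_zero.1 h0)
  · right
    apply Finset.eq_of_subset_of_card_le
    · intro x hx
      exact Finset.mem_erase.2 ⟨fun e => hvP (e ▸ hx), hP hx⟩
    · rw [Finset.card_erase_of_mem hv]; omega

lemma edgeCut_joint_le (l m : List V) (P : Finset V) : edgeCut (joint l m) P ≤ 1 := by
  unfold joint
  split
  · simp only [edgeCut_cons, edgeCut_nil]; split <;> simp
  · simp

lemma edgeCut_linEdges_eq_zero {l : List V} {P : Finset V}
    (h : (∀ x ∈ l, x ∈ P) ∨ ∀ x ∈ l, x ∉ P) : edgeCut (linEdges l) P = 0 := by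
  unfold edgeCut
  rw [List.sum_eq_zero_iff]
  intro n hn
  obtain ⟨p, hp, rfl⟩ := List.mem_map.1 hn
  have := mem_of_mem_linEdges hp
  rcases h with h | h
  · simp [h _ this.1, h _ this.2]
  · simp [h _ this.1, h _ this.2]

lemma edgeCut_cycEdges_le_four {a b c d : List V} {P : Finset V} (ha : ∀ x ∈ a, x ∈ P)
    (hb : ∀ x ∈ b, x ∉ P) (hc : ∀ x ∈ c, x ∈ P) (hd : ∀ x ∈ d, x ∉ P) :
    edgeCut (cycEdges (a ++ b ++ c ++ d)) P ≤ 4 := by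
  rw [cycEdges, linEdges_append, linEdges_append, linEdges_append]
  simp only [edgeCut_append]
  rw [edgeCut_linEdges_eq_zero (.inl ha), edgeCut_linEdges_eq_zero (.inr hb),
    edgeCut_linEdges_eq_zero (.inl hc), edgeCut_linEdges_eq_zero (.inr hd)]
  have := edgeCut_joint_le a b P
  have := edgeCut_joint_le (a ++ b) c P
  have := edgeCut_joint_le (a ++ b ++ c) d P
  have := edgeCut_joint_le (a ++ b ++ c ++ d) (a ++ b ++ c ++ d) P
  omega

lemma IsPrimeWord.ne_nil_of_sections {S : Finset V} {v : V} {A B : List V} (hS : 4 ≤ S.card)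
    (h : IsPrimeWord S (v :: A ++ v :: B)) : A ≠ [] := by
  rintro rfl
  have := h.isPrimeEdgeList.mul_self hS (h.mem v (by simp))
  simp [cycEdges, linEdges, joint] at this

/-- Four sections `s₁, s₂, s₃, s₄` that are cut by `v` in noncrossing ways. -/
lemma isRotated_of_noncrossing {S : Finset V} {v : V} {s₁ s₂ s₃ s₄ : List V} (hS : 4 ≤ S.card)
    (h : IsPrimeWord S (v :: s₁ ++ v :: (s₂ ++ s₃ ++ s₄)))
    (hv : v ∉ s₁ ++ s₂ ++ s₃ ++ s₄)
    (hc : ∀ x ∈ S, x ≠ v → (s₁.count x = 1 ↔ s₃.count x = 1)) :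
    (v :: s₁ ++ v :: (s₂ ++ s₃ ++ s₄)) ~r (s₁ ++ s₂ ++ v :: s₃ ++ v :: s₄) := by
  have hvS := h.mem v (by simp)
  simp only [List.mem_append, not_or] at hv
  have hcount : ∀ x ∈ S, x ≠ v → s₁.count x + s₂.count x + s₃.count x + s₄.count x = 2 := by
    intro x hx hxv
    have := h.count x hx
    simp [hxv.symm] at this
    omega
  set P : Finset V := (s₁ ++ s₃).toFinset with hPdef
  have hmem : ∀ x, x ∈ P ↔ x ∈ s₁ ∨ x ∈ s₃ := by intro x; simp [hPdef]
  have hPS : P ⊆ S := by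
    intro x hx
    apply h.mem
    rcases (hmem x).1 hx with hx | hx <;> simp [hx]
  have hvP : v ∉ P := by rw [hmem]; tauto
  have hdisj : ∀ x ∈ P, x ∉ s₂ ∧ x ∉ s₄ := by
    intro x hx
    have hxv : x ≠ v := by rintro rfl; exact hvP hx
    have h1 := hcount x (hPS hx) hxv
    have h2 := hc x (hPS hx) hxv
    rw [hmem, ← List.count_pos_iff, ← List.count_pos_iff] at hx
    rw [← List.count_eq_zero, ← List.count_eq_zero]
    omega
  have hcut1 : edgeCut (cycEdges (v :: s₁ ++ v :: (s₂ ++ s₃ ++ s₄))) P ≤ 4 := by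
    rw [edgeCut_cycEdges_isRotated (l' := s₁ ++ (v :: s₂) ++ s₃ ++ (s₄ ++ [v]))]
    · apply edgeCut_cycEdges_le_four <;> grind
    · simpa using List.isRotated_append (l := [v]) (l' := s₁ ++ v :: (s₂ ++ s₃ ++ s₄))
  have hcut2 : edgeCut (cycEdges (v :: s₁ ++ v :: (s₂ ++ s₃ ++ s₄))) (insert v P) ≤ 4 := by
    rw [show v :: s₁ ++ v :: (s₂ ++ s₃ ++ s₄) = (v :: s₁ ++ [v]) ++ s₂ ++ s₃ ++ s₄ by simp]
    apply edgeCut_cycEdges_le_four <;> grind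
  rcases h.eq_empty_or_of_cut_le hS hvS hPS hvP hcut1 hcut2 with hP | hP
  · exfalso
    refine h.ne_nil_of_sections hS (List.eq_nil_iff_forall_not_mem.2 fun x hx => ?_)
    have := (hmem x).2 (.inl hx)
    simp [hP] at this
  · have e2 : s₂ = [] := List.eq_nil_iff_forall_not_mem.2 fun x hx => by
      have : x ∈ P := by
        rw [hP, Finset.mem_erase]
        exact ⟨by rintro rfl; tauto, h.mem x (by simp [hx])⟩
      exact (hdisj x this).1 hx
    have e4 : s₄ = [] := List.eq_nil_iff_forall_not_mem.2 fun x hx => by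
      have : x ∈ P := by
        rw [hP, Finset.mem_erase]
        exact ⟨by rintro rfl; tauto, h.mem x (by simp [hx])⟩
      exact (hdisj x this).2 hx
    subst e2 e4
    simpa using List.isRotated_append (l := [v]) (l' := s₁ ++ v :: s₃)

/-- Four sections `s₁, s₂, s₃, s₄` that are cut by `v` in crossing ways. -/
lemma isRotated_of_crossing {S : Finset V} {v : V} {s₁ s₂ s₃ s₄ : List V} (hS : 4 ≤ S.card)
    (h : IsPrimeWord S (v :: (s₁ ++ s₂) ++ v :: (s₃ ++ s₄)))
    (hv : v ∉ s₁ ++ s₂ ++ s₃ ++ s₄)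
    (hc : ∀ x ∈ S, x ≠ v → (s₁.count x + s₂.count x = 1 ↔ s₂.count x + s₃.count x = 1)) :
    (v :: (s₁ ++ s₂) ++ v :: (s₃ ++ s₄)) ~r (s₁ ++ v :: (s₂ ++ s₃) ++ v :: s₄) := by
  have hvS := h.mem v (by simp)
  simp only [List.mem_append, not_or] at hv
  have hcount : ∀ x ∈ S, x ≠ v → s₁.count x + s₂.count x + s₃.count x + s₄.count x = 2 := by
    intro x hx hxv
    have := h.count x hx
    simp [hxv.symm] at this
    omega
  set P : Finset V := (s₁ ++ s₃).toFinset with hPdef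
  have hmem : ∀ x, x ∈ P ↔ x ∈ s₁ ∨ x ∈ s₃ := by intro x; simp [hPdef]
  have hPS : P ⊆ S := by
    intro x hx
    apply h.mem
    rcases (hmem x).1 hx with hx | hx <;> simp [hx]
  have hvP : v ∉ P := by rw [hmem]; tauto
  have hdisj : ∀ x ∈ P, x ∉ s₂ ∧ x ∉ s₄ := by
    intro x hx
    have hxv : x ≠ v := by rintro rfl; exact hvP hx
    have h1 := hcount x (hPS hx) hxv
    have h2 := hc x (hPS hx) hxv
    rw [hmem, ← List.count_pos_iff, ← List.count_pos_iff] at hx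
    rw [← List.count_eq_zero, ← List.count_eq_zero]
    omega
  have hcut1 : edgeCut (cycEdges (v :: (s₁ ++ s₂) ++ v :: (s₃ ++ s₄))) P ≤ 4 := by
    rw [edgeCut_cycEdges_isRotated (l' := s₁ ++ (s₂ ++ [v]) ++ s₃ ++ (s₄ ++ [v]))]
    · apply edgeCut_cycEdges_le_four <;> grind
    · simpa using List.isRotated_append (l := [v]) (l' := s₁ ++ s₂ ++ v :: (s₃ ++ s₄))
  have hcut2 : edgeCut (cycEdges (v :: (s₁ ++ s₂) ++ v :: (s₃ ++ s₄))) (insert v P) ≤ 4 := by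
    rw [show v :: (s₁ ++ s₂) ++ v :: (s₃ ++ s₄) = (v :: s₁) ++ s₂ ++ (v :: s₃) ++ s₄ by simp]
    apply edgeCut_cycEdges_le_four <;> grind
  rcases h.eq_empty_or_of_cut_le hS hvS hPS hvP hcut1 hcut2 with hP | hP
  · have e1 : s₁ = [] := List.eq_nil_iff_forall_not_mem.2 fun x hx => by
      have := (hmem x).2 (.inl hx)
      simp [hP] at this
    have e3 : s₃ = [] := List.eq_nil_iff_forall_not_mem.2 fun x hx => by
      have := (hmem x).2 (.inr hx)
      simp [hP] at this
    subst e1 e3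
    simpa using List.IsRotated.refl _
  · have e2 : s₂ = [] := List.eq_nil_iff_forall_not_mem.2 fun x hx => by
      have : x ∈ P := by
        rw [hP, Finset.mem_erase]
        exact ⟨by rintro rfl; tauto, h.mem x (by simp [hx])⟩
      exact (hdisj x this).1 hx
    have e4 : s₄ = [] := List.eq_nil_iff_forall_not_mem.2 fun x hx => by
      have : x ∈ P := by
        rw [hP, Finset.mem_erase]
        exact ⟨by rintro rfl; tauto, h.mem x (by simp [hx])⟩
      exact (hdisj x this).2 hx
    subst e2 e4
    simpa using List.isRotated_append (l := [v]) (l' := s₁ ++ v :: s₃)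

end Circuits

section Reduction

variable {V : Type*} [DecidableEq V]

lemma isRotated_of_sections {S : Finset V} {v : V} {A B X C Z : List V} (hS : 4 ≤ S.card)
    (h : IsPrimeWord S (v :: A ++ v :: B)) (hA : v ∉ A) (hB : v ∉ B)
    (he : A ++ B = X ++ C ++ Z)
    (hc : ∀ x ∈ S, x ≠ v → (A.count x = 1 ↔ C.count x = 1)) :
    (v :: A ++ v :: B) ~r (X ++ v :: C ++ v :: Z) := by
  have hnot : v ∉ X ++ C ++ Z := by rw [← he]; simp [hA, hB]
  have hcount : ∀ x ∈ S, x ≠ v → A.count x + B.count x = 2 := fun x hx hxv =>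
    h.toIsDoubleWord.count_sections hxv hx
  rw [List.append_assoc] at he
  rcases List.append_eq_append_iff.1 he with ⟨s, rfl, rfl⟩ | ⟨s, rfl, hs⟩
  · rw [← List.append_assoc] at h ⊢
    exact isRotated_of_noncrossing hS h (by simpa using hnot) hc
  rcases List.append_eq_append_iff.1 hs with ⟨t, rfl, rfl⟩ | ⟨t, rfl, rfl⟩
  · have h' := h.isRotated (isRotated_swap v (X ++ (C ++ t)) B)
    have := isRotated_of_noncrossing (s₁ := B) (s₂ := X) (s₃ := C) (s₄ := t) hS
      (by simpa using h') (by simp at hnot ⊢; tauto) (fun x hx hxv => by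
        rw [← hc x hx hxv]; have := hcount x hx hxv; omega)
    refine (isRotated_swap v (X ++ (C ++ t)) B).trans ?_
    rw [List.append_assoc] at this
    refine this.trans ?_
    have h3 := List.isRotated_append (l := B) (l' := X ++ (v :: C ++ v :: t))
    simpa using h3
  · have := isRotated_of_crossing hS h (by simp at hnot ⊢; tauto) (fun x hx hxv => by
      have := hc x hx hxv
      simpa using this)
    simpa using this

lemma SameAlt.count_sections {S : Finset V} {v : V} {A B A' B' : List V}
    (h : IsDoubleWord S (v :: A ++ v :: B)) (h' : IsDoubleWord S (v :: A' ++ v :: B'))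
    (hA : v ∉ A) (hB : v ∉ B) (hA' : v ∉ A') (hB' : v ∉ B')
    (hs : SameAlt (v :: A ++ v :: B) (v :: A' ++ v :: B')) :
    ∀ y ∈ S, y ≠ v → (A.count y = 1 ↔ A'.count y = 1) := by
  intro y hyS hy
  rw [← alt_cons_append_cons hA hB hy (h.count_sections hy hyS),
    ← alt_cons_append_cons hA' hB' hy (h'.count_sections hy hyS)]
  exact hs v y hy.symm

lemma isRotated_insert {S : Finset V} {v : V} {A B A' B' : List V} (hS : 4 ≤ S.card)
    (h : IsPrimeWord S (v :: A ++ v :: B)) (h' : IsDoubleWord S (v :: A' ++ v :: B'))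
    (hA : v ∉ A) (hB : v ∉ B) (hA' : v ∉ A') (hB' : v ∉ B')
    (hs : SameAlt (v :: A ++ v :: B) (v :: A' ++ v :: B'))
    (hr : (A ++ B) ~r (A' ++ B')) : (v :: A ++ v :: B) ~r (v :: A' ++ v :: B') := by
  have hc := hs.count_sections h.toIsDoubleWord h' hA hB hA' hB'
  obtain ⟨X, Y, h1, h2⟩ := exists_append_of_isRotated hr
  rcases List.append_eq_append_iff.1 h2 with ⟨s, rfl, rfl⟩ | ⟨s, rfl, rfl⟩
  · have := isRotated_of_sections hS h hA hB (by rw [h1, List.append_assoc]) hc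
    refine this.trans ?_
    have h3 := List.isRotated_append (l := X) (l' := v :: A' ++ v :: s)
    simpa using h3
  · have := isRotated_of_sections (C := B') (X := s) (Z := Y) hS h hA hB h1 fun x hx hxv => by
      rw [hc x hx hxv]
      have := h'.count_sections hxv hx
      omega
    refine this.trans (List.IsRotated.trans ?_ (isRotated_swap v B' (Y ++ s)))
    have h3 := List.isRotated_append (l := s) (l' := v :: B' ++ v :: Y)
    simpa using h3

/-- A prime circuit is determined by its alternating pairs together with
the circuit obtained by deleting one letter. -/
lemma sameCircuit_insert {S : Finset V} {v : V} {A B A' B' : List V} (hS : 4 ≤ S.card)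
    (h : IsPrimeWord S (v :: A ++ v :: B)) (h' : IsDoubleWord S (v :: A' ++ v :: B'))
    (hA : v ∉ A) (hB : v ∉ B) (hA' : v ∉ A') (hB' : v ∉ B')
    (hs : SameAlt (v :: A ++ v :: B) (v :: A' ++ v :: B'))
    (hr : SameCircuit (A ++ B) (A' ++ B')) :
    SameCircuit (v :: A ++ v :: B) (v :: A' ++ v :: B') := by
  rcases hr with hr | hr
  · exact .inl (isRotated_insert hS h h' hA hB hA' hB' hs hr)
  have hrev := reverse_sections_isRotated v A B
  have hsym : SameAlt (v :: A ++ v :: B).reverse (v :: A ++ v :: B) := fun _ _ _ => alt_reverse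
  refine .inr (hrev.trans ?_)
  have h1 : IsPrimeWord S (v :: A ++ v :: B).reverse :=
    h.of_cut (List.reverse_perm _).symm fun P => (edgeCut_cycEdges_reverse _ P).symm
  refine isRotated_insert hS (h1.isRotated hrev) h' (by simpa using hA) (by simpa using hB)
    hA' hB' ((sameAlt_of_isRotated hrev).symm.trans (hsym.trans hs)) (List.IsRotated.trans ?_ hr)
  simpa using List.isRotated_append (l := A.reverse) (l' := B.reverse)

lemma SameAlt.del {v : V} {A B A' B' : List V}
    (hA : v ∉ A) (hB : v ∉ B) (hA' : v ∉ A') (hB' : v ∉ B')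
    (hs : SameAlt (v :: A ++ v :: B) (v :: A' ++ v :: B')) : SameAlt (A ++ B) (A' ++ B') := by
  intro x y hxy
  by_cases hx : x = v
  · refine iff_of_false (fun hh => ?_) (fun hh => ?_)
    · have := hh.mem.1; simp_all
    · have := hh.mem.1; simp_all
  by_cases hy : y = v
  · refine iff_of_false (fun hh => ?_) (fun hh => ?_)
    · have := hh.mem.2; simp_all
    · have := hh.mem.2; simp_all
  rw [← alt_del (A := A) (B := B) hx hy, ← alt_del (A := A') (B := B') hx hy]
  exact hs x y hxy

lemma IsDoubleWord.del {S : Finset V} {v : V} {A B : List V} (hA : v ∉ A) (hB : v ∉ B)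
    (h : IsDoubleWord S (v :: A ++ v :: B)) : IsDoubleWord (S.erase v) (A ++ B) where
  count y hy := by
    rw [List.count_append]
    exact h.count_sections (Finset.ne_of_mem_erase hy) (Finset.mem_of_mem_erase hy)
  mem y hy := by
    refine Finset.mem_erase.2 ⟨by rintro rfl; simp_all, h.mem y ?_⟩
    simp at hy ⊢; tauto

lemma IsRigid.of_del {S : Finset V} {v : V} {A B : List V} (hS : 4 ≤ S.card)
    (h : IsPrimeWord S (v :: A ++ v :: B)) (hA : v ∉ A) (hB : v ∉ B)
    (hr : IsRigid (S.erase v) (A ++ B)) : IsRigid S (v :: A ++ v :: B) := by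
  intro l' hl' ha
  obtain ⟨A', B', hr', hA', hB'⟩ := exists_sections (hl'.count v (h.mem v (by simp)))
  have hl'' := hl'.perm hr'.perm
  have ha' := ha.trans (sameAlt_of_isRotated hr')
  refine SameCircuit.trans ?_ (.inl hr'.symm)
  exact sameCircuit_insert hS h hl'' hA hB hA' hB' ha'
    (hr _ (hl''.del hA' hB') (ha'.del hA hB hA' hB'))

omit [DecidableEq V] in
lemma cycEdges_sections_perm {v : V} {A B : List V} {a₁ a₂ b₁ b₂ : V}
    (ha₁ : A.head? = some a₁) (ha₂ : A.getLast? = some a₂) (hb₁ : B.head? = some b₁)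
    (hb₂ : B.getLast? = some b₂) :
    (cycEdges (v :: A ++ v :: B)).Perm
      ([(v, a₁), (a₂, v), (v, b₁), (b₂, v)] ++ (linEdges A ++ linEdges B)) := by
  have hA : A ≠ [] := by rintro rfl; simp at ha₁
  have hB : B ≠ [] := by rintro rfl; simp at hb₁
  rw [cycEdges_append (by simp) (by simp), linEdges, linEdges,
    show v :: A = [v] ++ A from rfl, show v :: B = [v] ++ B from rfl,
    joint_append_left hA, joint_append_left hB, joint_append_right (by simp),
    joint_append_right (by simp)]
  simp only [joint, ha₁, ha₂, hb₁, hb₂, List.getLast?_singleton, List.head?_cons]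
  classical
  rw [List.perm_iff_count]
  intro p
  simp only [List.count_append, List.count_cons, List.count_nil]
  ring

omit [DecidableEq V] in
lemma cycEdges_perm_of_isRotated {l l' : List V} (h : l ~r l') :
    (cycEdges l).Perm (cycEdges l') := by
  obtain ⟨X, Y, rfl, rfl⟩ := exists_append_of_isRotated h
  by_cases hX : X = []
  · simp [hX]
  by_cases hY : Y = []
  · simp [hY]
  rw [cycEdges_append hX hY, cycEdges_append hY hX]
  classical
  rw [List.perm_iff_count]
  intro p
  simp only [List.count_append]
  ring

lemma IsPrimeWord.isNeighborList_sections {S : Finset V} {v : V} {A B : List V} {a₁ a₂ b₁ b₂ : V}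
    (hS : 4 ≤ S.card) (h : IsPrimeWord S (v :: A ++ v :: B)) (hA : v ∉ A) (hB : v ∉ B)
    (ha₁ : A.head? = some a₁) (ha₂ : A.getLast? = some a₂) (hb₁ : B.head? = some b₁)
    (hb₂ : B.getLast? = some b₂) :
    IsPrimeEdgeList.IsNeighborList S (cycEdges (v :: A ++ v :: B)) v [a₁, a₂, b₁, b₂] := by
  have hp := cycEdges_sections_perm (v := v) ha₁ ha₂ hb₁ hb₂
  have ha₁A := List.mem_of_mem_head? ha₁
  have ha₂A := List.mem_of_getLast? ha₂
  have hb₁B := List.mem_of_mem_head? hb₁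
  have hb₂B := List.mem_of_getLast? hb₂
  have hzero : ∀ l : List V, v ∉ l → ∀ x, edgeMul (linEdges l) v x = 0 := by
    intro l hl x
    unfold edgeMul
    rw [List.sum_eq_zero_iff]
    intro n hn
    obtain ⟨p, hp, rfl⟩ := List.mem_map.1 hn
    have := mem_of_mem_linEdges hp
    rw [if_neg]
    rintro (h | h)
    · exact hl (h.1 ▸ this.1)
    · exact hl (h.2 ▸ this.2)
  have hmul : ∀ x, x ≠ v → edgeMul (cycEdges (v :: A ++ v :: B)) v x
      = (if a₁ = x then 1 else 0) + (if a₂ = x then 1 else 0) + (if b₁ = x then 1 else 0)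
        + (if b₂ = x then 1 else 0) := by
    intro x hx
    rw [edgeMul, (hp.map _).sum_eq, ← edgeMul, edgeMul_append, edgeMul_append, hzero A hA,
      hzero B hB]
    simp [hx.symm, add_assoc]
  have hle : ∀ x ∈ S, edgeMul (cycEdges (v :: A ++ v :: B)) v x ≤ 1 := fun x hx =>
    h.isPrimeEdgeList.mul_le hS (h.mem v (by simp)) hx
  have hAS : ∀ x ∈ A, x ∈ S ∧ x ≠ v := fun x hx => ⟨h.mem x (by simp [hx]), by rintro rfl; tauto⟩
  have hBS : ∀ x ∈ B, x ∈ S ∧ x ≠ v := fun x hx => ⟨h.mem x (by simp [hx]), by rintro rfl; tauto⟩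
  have m1 := hmul a₁ (hAS a₁ ha₁A).2
  have m2 := hmul a₂ (hAS a₂ ha₂A).2
  have m3 := hmul b₁ (hBS b₁ hb₁B).2
  have m4 := hmul b₂ (hBS b₂ hb₂B).2
  have l1 := hle a₁ (hAS a₁ ha₁A).1
  have l2 := hle a₂ (hAS a₂ ha₂A).1
  have l3 := hle b₁ (hBS b₁ hb₁B).1
  have l4 := hle b₂ (hBS b₂ hb₂B).1
  simp only [if_true] at m1 m2 m3 m4
  refine ⟨?_, ?_, ?_⟩
  · simp only [List.nodup_cons, List.mem_cons, List.not_mem_nil, or_false, not_or]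
    have := (hAS a₁ ha₁A).2
    have := (hAS a₂ ha₂A).2
    have := (hBS b₁ hb₁B).2
    have := (hBS b₂ hb₂B).2
    refine ⟨⟨?_, ?_, ?_, ?_⟩, ⟨?_, ?_, ?_⟩, ⟨?_, ?_⟩, ?_, by simp⟩ <;> intro e <;>
      first
        | (subst e; contradiction)
        | (rw [if_pos e] at m2; omega)
        | (rw [if_pos e] at m3; omega)
        | (rw [if_pos e] at m4; omega)
  · intro x hx
    simp only [List.mem_cons, List.not_mem_nil, or_false] at hx
    rcases hx with rfl | rfl | rfl | rfl
    · exact ⟨(hAS _ ha₁A).1, by omega⟩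
    · exact ⟨(hAS _ ha₂A).1, by omega⟩
    · exact ⟨(hBS _ hb₁B).1, by omega⟩
    · exact ⟨(hBS _ hb₂B).1, by omega⟩
  · intro x hx hxN
    simp only [List.mem_cons, List.not_mem_nil, or_false, not_or] at hxN
    by_cases hxv : x = v
    · rw [hxv]; exact h.isPrimeEdgeList.mul_self hS (h.mem v (by simp))
    · rw [hmul x hxv]; grind

open IsPrimeEdgeList in
lemma IsBad.congr {S : Finset V} {E E' : List (V × V)} {v a b c d : V}
    (hb : IsBad S E v a b c d) (hE : ∀ P, edgeCut E P = edgeCut E' P) : IsBad S E' v a b c d := by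
  obtain ⟨A, h⟩ := hb
  rw [hE] at h
  exact ⟨A, h⟩

/-- Deleting `v` keeps primality if the resulting pairing is not bad. -/
lemma IsPrimeWord.del {S : Finset V} {v : V} {A B : List V} {a₁ a₂ b₁ b₂ : V}
    (hS : 4 ≤ S.card) (h : IsPrimeWord S (v :: A ++ v :: B)) (hA : v ∉ A) (hB : v ∉ B)
    (ha₁ : A.head? = some a₁) (ha₂ : A.getLast? = some a₂) (hb₁ : B.head? = some b₁)
    (hb₂ : B.getLast? = some b₂)
    (hbad : ¬ IsPrimeEdgeList.IsBad S (cycEdges (v :: A ++ v :: B)) v a₂ b₁ b₂ a₁) :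
    IsPrimeWord (S.erase v) (A ++ B) := by
  refine ⟨h.toIsDoubleWord.del hA hB, fun P hP h1 h2 => ?_⟩
  have hN := h.isNeighborList_sections hS hA hB ha₁ ha₂ hb₁ hb₂
  have hN' := hN.perm (List.perm_append_comm (l₁ := [a₁]) (l₂ := [a₂, b₁, b₂]))
  have hp := cycEdges_sections_perm (v := v) ha₁ ha₂ hb₁ hb₂
  have hA0 : A ≠ [] := by rintro rfl; simp at ha₁
  have hB0 : B ≠ [] := by rintro rfl; simp at hb₁
  have := h.isPrimeEdgeList.cut_splitOff hS (h.mem v (by simp)) hN' hbad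
    (E₀ := linEdges A ++ linEdges B) (fun P => by
      rw [edgeCut, (hp.map _).sum_eq, ← edgeCut, edgeCut_append]
      congr 1
      simp only [edgeCut_cons, edgeCut_nil, iff_comm (a := v ∈ P)]
      omega) (fun p hp => by
      rw [List.mem_append] at hp
      have : ∀ l : List V, v ∉ l → p ∈ linEdges l → p.1 ≠ v ∧ p.2 ≠ v := fun l hl hpl =>
        ⟨fun e => hl (e ▸ (mem_of_mem_linEdges hpl).1), fun e => hl (e ▸ (mem_of_mem_linEdges hpl).2)⟩
      exact hp.elim (this A hA) (this B hB)) hP h1 h2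
  rw [cycEdges_append hA0 hB0]
  simp only [joint, ha₁, ha₂, hb₁, hb₂]
  simp only [edgeCut_append, edgeCut_cons, edgeCut_nil] at this ⊢
  omega

section

variable {S : Finset V} {v : V} {A B : List V} {a₁ a₂ b₁ b₂ : V}

lemma isRigid_of_not_isBad_cross (hS : 4 ≤ S.card)
    (ih : ∀ l, IsPrimeWord (S.erase v) l → IsRigid (S.erase v) l)
    (h : IsPrimeWord S (v :: A ++ v :: B)) (hA : v ∉ A) (hB : v ∉ B)
    (ha₁ : A.head? = some a₁) (ha₂ : A.getLast? = some a₂) (hb₁ : B.head? = some b₁)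
    (hb₂ : B.getLast? = some b₂)
    (hbad : ¬ IsPrimeEdgeList.IsBad S (cycEdges (v :: A ++ v :: B)) v a₂ b₁ b₂ a₁) :
    IsRigid S (v :: A ++ v :: B) :=
  IsRigid.of_del hS h hA hB (ih _ (h.del hS hA hB ha₁ ha₂ hb₁ hb₂ hbad))

lemma isRigid_of_not_isBad_parallel (hS : 4 ≤ S.card)
    (ih : ∀ l, IsPrimeWord (S.erase v) l → IsRigid (S.erase v) l)
    (h : IsPrimeWord S (v :: A ++ v :: B)) (hA : v ∉ A) (hB : v ∉ B)
    (ha₁ : A.head? = some a₁) (ha₂ : A.getLast? = some a₂) (hb₁ : B.head? = some b₁)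
    (hb₂ : B.getLast? = some b₂)
    (hbad : ¬ IsPrimeEdgeList.IsBad S (cycEdges (v :: A ++ v :: B)) v a₁ b₁ a₂ b₂) :
    IsRigid S (v :: A ++ v :: B) := by
  have hN := h.isNeighborList_sections hS hA hB ha₁ ha₂ hb₁ hb₂
  refine IsRigid.of_localCompl h.toIsDoubleWord hA hB ?_
  refine isRigid_of_not_isBad_cross hS ih h.localCompl hA (by simpa using hB) ha₁ ha₂
    (by simpa using hb₂) (by simpa using hb₁) fun hb => hbad ?_
  have hb := IsBad.congr hb fun P => edgeCut_linEdges_reverse_right v P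
  obtain ⟨P, hP⟩ := IsPrimeEdgeList.IsBad.compl h.isPrimeEdgeList hS (h.mem v (by simp))
    (hN.perm (show [a₁, a₂, b₁, b₂].Perm [a₂, b₂, b₁, a₁] by grind)) hb
  exact ⟨P, by tauto⟩

lemma isRigid_of_not_isBad_self (hS : 4 ≤ S.card)
    (ih : ∀ l, IsPrimeWord (S.erase v) l → IsRigid (S.erase v) l)
    (h : IsPrimeWord S (v :: A ++ v :: B)) (hA : v ∉ A) (hB : v ∉ B)
    (ha₁ : A.head? = some a₁) (ha₂ : A.getLast? = some a₂) (hb₁ : B.head? = some b₁)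
    (hb₂ : B.getLast? = some b₂)
    (hbad : ¬ IsPrimeEdgeList.IsBad S (cycEdges (v :: A ++ v :: B)) v a₁ a₂ b₁ b₂) :
    IsRigid S (v :: A ++ v :: B) := by
  have hvS := h.mem v (by simp)
  have hN := h.isNeighborList_sections hS hA hB ha₁ ha₂ hb₁ hb₂
  have hnd := hN.nodup
  simp only [List.nodup_cons, List.mem_cons, List.not_mem_nil, or_false, not_or] at hnd
  have ha₁A := List.mem_of_mem_head? ha₁
  have ha₂A := List.mem_of_getLast? ha₂
  have hb₁B := List.mem_of_mem_head? hb₁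
  have hb₂B := List.mem_of_getLast? hb₂
  obtain ⟨u, huA, huB⟩ : ∃ u ∈ A, u ∈ B := by
    by_contra! hcon
    have h1 := h.cut A.toFinset (fun x hx => h.mem x (by simp at hx; simp [hx]))
      (by
        rw [← Finset.card_pair (show a₁ ≠ a₂ by tauto)]
        exact Finset.card_le_card (by simp [Finset.insert_subset_iff, ha₁A, ha₂A]))
      (by
        rw [← Finset.card_pair (show b₁ ≠ b₂ by tauto)]
        refine Finset.card_le_card fun x hx => ?_
        have hxB : x ∈ B := by simp at hx; rcases hx with rfl | rfl <;> assumption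
        rw [Finset.mem_sdiff]
        exact ⟨h.mem x (by simp [hxB]), by simp; exact fun hxA => hcon x hxA hxB⟩)
    have h2 := edgeCut_cycEdges_le_four (a := A) (b := v :: B ++ [v]) (c := []) (d := [])
      (P := A.toFinset) (by simp)
      (fun x hx hxA => by
        simp only [List.mem_toFinset, List.mem_append, List.mem_cons, List.not_mem_nil,
          or_false] at hx hxA
        rcases hx with (rfl | hx) | rfl
        · exact hA hxA
        · exact hcon x hxA hx
        · exact hA hxA) (by simp) (by simp)
    rw [edgeCut_cycEdges_isRotated (l' := v :: A ++ v :: B)] at h2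
    · omega
    · have := List.isRotated_append (l := A ++ v :: B) (l' := [v])
      simpa using this
  have huv : u ≠ v := by rintro rfl; exact hA huA
  obtain ⟨A₁, A₂, rfl⟩ := List.append_of_mem huA
  obtain ⟨B₁, B₂, rfl⟩ := List.append_of_mem huB
  have hu : u ∉ A₁ ∧ u ∉ A₂ ∧ u ∉ B₁ ∧ u ∉ B₂ := by
    have := h.count u (h.mem u (by simp))
    simp [huv.symm] at this
    simp only [← List.count_eq_zero]
    omega
  have r1 : (v :: (A₁ ++ u :: A₂) ++ v :: (B₁ ++ u :: B₂)) ~r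
      (u :: (A₂ ++ v :: B₁) ++ u :: (B₂ ++ v :: A₁)) := by
    have := List.isRotated_append (l := v :: A₁) (l' := u :: A₂ ++ v :: (B₁ ++ u :: B₂))
    simpa using this
  have r2 : (u :: (A₂ ++ v :: B₁) ++ u :: (B₂ ++ v :: A₁).reverse) ~r
      (v :: (B₁ ++ u :: A₁.reverse) ++ v :: (B₂.reverse ++ u :: A₂)) := by
    have := List.isRotated_append (l := u :: A₂)
      (l' := v :: (B₁ ++ u :: A₁.reverse) ++ v :: B₂.reverse)
    simpa using this
  have h1 := h.isRotated r1
  have h3 := h1.localCompl.isRotated r2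
  refine IsRigid.isRotated ?_ r1.symm
  refine IsRigid.of_localCompl h1.toIsDoubleWord (by simp; tauto) (by simp; tauto) ?_
  refine IsRigid.isRotated ?_ r2.symm
  have head_eq : ∀ X Y Z : List V, (X ++ u :: Y).head? = (X ++ u :: Z).head? := by
    intro X Y Z; cases X <;> simp
  have last_eq : ∀ X Y Z : List V, (Y ++ u :: X).getLast? = (Z ++ u :: X).getLast? := by
    intro X Y Z
    rw [List.getLast?_append_of_ne_nil _ (by simp), List.getLast?_append_of_ne_nil _ (by simp)]
  refine isRigid_of_not_isBad_parallel hS ih h3 (by simp at hA hB ⊢; tauto)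
    (by simp at hA hB ⊢; tauto) (a₁ := b₁) (a₂ := a₁) (b₁ := b₂) (b₂ := a₂) ?_ ?_ ?_ ?_ ?_
  · rw [← hb₁]; exact head_eq _ _ _
  · rw [last_eq A₁.reverse B₁ A₂.reverse, ← ha₁, ← List.getLast?_reverse]; simp
  · rw [head_eq B₂.reverse A₂ B₁.reverse, ← hb₂, ← List.head?_reverse]; simp
  · rw [← ha₂]; exact last_eq _ _ _
  · intro hb
    refine hbad ?_
    have hb' := IsBad.congr hb fun P =>
      ((edgeCut_cycEdges_isRotated r2 P).symm.trans (edgeCut_linEdges_reverse_right u P)).trans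
        (edgeCut_cycEdges_isRotated r1 P).symm
    exact IsPrimeEdgeList.IsBad.compl h.isPrimeEdgeList hS hvS
      (hN.perm (List.perm_append_comm (l₁ := [a₁, a₂]) (l₂ := [b₁, b₂]))) hb'

end

/-- Reduction of rigidity to words with one letter less. -/
lemma IsPrimeWord.isRigid_of_erase {S : Finset V} {l : List V} (h : IsPrimeWord S l)
    (hS : 6 ≤ S.card)
    (ih : ∀ v ∈ S, ∀ l, IsPrimeWord (S.erase v) l → IsRigid (S.erase v) l) : IsRigid S l := by
  obtain ⟨v, hv, hbad⟩ := h.isPrimeEdgeList.exists_not_isBad hS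
  obtain ⟨A, B, hr, hA, hB⟩ := exists_sections (h.count v hv)
  have h' := h.isRotated hr
  have hS' : 4 ≤ S.card := by omega
  have hA0 := h'.ne_nil_of_sections hS'
  have hB0 := (h'.isRotated (isRotated_swap v A B)).ne_nil_of_sections hS'
  refine IsRigid.isRotated ?_ hr.symm
  have ha₁ := List.head?_eq_some_head hA0
  have ha₂ := List.getLast?_eq_some_getLast hA0
  have hb₁ := List.head?_eq_some_head hB0
  have hb₂ := List.getLast?_eq_some_getLast hB0
  generalize A.head hA0 = a₁ at *
  generalize A.getLast hA0 = a₂ at *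
  generalize B.head hB0 = b₁ at *
  generalize B.getLast hB0 = b₂ at *
  have hc := edgeCut_cycEdges_isRotated hr
  have hN := h'.isNeighborList_sections hS' hA hB ha₁ ha₂ hb₁ hb₂
  have hmul : ∀ x y, edgeMul (cycEdges l) x y = edgeMul (cycEdges (v :: A ++ v :: B)) x y := by
    intro x y
    rw [edgeMul, ((cycEdges_perm_of_isRotated hr).map _).sum_eq, edgeMul]
  rcases hbad a₁ a₂ b₁ b₂ ⟨hN.nodup, by simpa only [hmul] using hN.mul_mem,
    by simpa only [hmul] using hN.mul_notMem⟩ with hb | hb | hb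
  · exact isRigid_of_not_isBad_self hS' (ih v hv) h' hA hB ha₁ ha₂ hb₁ hb₂
      fun hb' => hb (IsBad.congr hb' fun P => (hc P).symm)
  · exact isRigid_of_not_isBad_parallel hS' (ih v hv) h' hA hB ha₁ ha₂ hb₁ hb₂
      fun hb' => hb (IsBad.congr hb' fun P => (hc P).symm)
  · refine isRigid_of_not_isBad_cross hS' (ih v hv) h' hA hB ha₁ ha₂ hb₁ hb₂
      fun hb' => hb (IsBad.congr ?_ fun P => (hc P).symm)
    obtain ⟨P, hP⟩ := IsPrimeEdgeList.IsBad.compl h'.isPrimeEdgeList hS' hv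
      (hN.perm (List.perm_append_comm (l₁ := [a₁]) (l₂ := [a₂, b₁, b₂]))) hb'
    exact ⟨P, by tauto⟩

end Reduction

section Enumeration

/-- The words over `Fin n` obtained from `t` by prepending `k` letters,
all of whose intermediate words satisfy `P`. -/
def extendWord {n : ℕ} (P : List (Fin n) → Bool) (t : List (Fin n)) : ℕ → List (List (Fin n))
  | 0 => [t]
  | k + 1 => (extendWord P t k).flatMap fun s => ((List.finRange n).map (· :: s)).filter P

lemma mem_extendWord {n : ℕ} {P : List (Fin n) → Bool} (hP : ∀ x s, P (x :: s) → P s)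
    (t s : List (Fin n)) (h : P (s ++ t)) : s ++ t ∈ extendWord P t s.length := by
  induction s with
  | nil => simp [extendWord]
  | cons a s ih =>
    simp only [List.length_cons, extendWord, List.mem_flatMap, List.mem_filter, List.mem_map]
    exact ⟨s ++ t, ih (hP _ _ h), ⟨a, List.mem_finRange a, rfl⟩, h⟩

/-- No letter occurs more than twice. -/
def countLe {n : ℕ} (t : List (Fin n)) : Bool :=
  (List.finRange n).all fun i => t.count i ≤ 2

/-- The multigraph of consecutive letters has neither loops nor parallel edges. -/
def edgeSimple {n : ℕ} (t : List (Fin n)) : Bool :=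
  (List.finRange n).all fun i => (List.finRange n).all fun j =>
    edgeMul (linEdges t) i j ≤ if i = j then 0 else 1

lemma countLe_of_cons {n : ℕ} (x : Fin n) (s : List (Fin n)) (h : countLe (x :: s)) :
    countLe s := by
  simp only [countLe, List.all_eq_true, List.mem_finRange, decide_eq_true_eq, forall_const] at h ⊢
  intro i
  have := h i
  have := List.count_le_count_cons (a := i) (b := x) (l := s)
  omega

lemma edgeSimple_of_cons {n : ℕ} (x : Fin n) (s : List (Fin n)) (h : edgeSimple (x :: s)) :
    edgeSimple s := by
  simp only [edgeSimple, List.all_eq_true, List.mem_finRange, decide_eq_true_eq,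
    forall_const] at h ⊢
  intro i j
  have := h i j
  rw [linEdges, edgeMul_append] at this
  omega

lemma IsDoubleWord.countLe {n : ℕ} {l : List (Fin n)} (h : IsDoubleWord Finset.univ l) :
    countLe l := by
  simp only [_root_.countLe, List.all_eq_true, List.mem_finRange, decide_eq_true_eq, forall_const]
  exact fun i => (h.count i (Finset.mem_univ i)).le

lemma IsDoubleWord.length {V : Type*} [DecidableEq V] {S : Finset V} {l : List V}
    (h : IsDoubleWord S l) : l.length = 2 * S.card := by
  have := Multiset.sum_count_eq_card (s := S) (m := (l : Multiset V)) h.mem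
  simp only [Multiset.coe_card, Multiset.coe_count] at this
  rw [← this, Finset.sum_congr rfl (g := fun _ => 2) (fun v hv => h.count v hv)]
  simp [mul_comm]

instance {V : Type*} [DecidableEq V] (l : List V) (u v : V) : Decidable (Alt l u v) :=
  inferInstanceAs (Decidable (_ ∨ _))

instance {V : Type*} [DecidableEq V] (l l' : List V) : Decidable (SameCircuit l l') :=
  inferInstanceAs (Decidable (_ ∨ _))

/-- Whether the word is, after deletion of a letter, a word of a path on four vertices. -/
def hasPath (l : List (Fin 5)) : Bool :=
  (extendWord (fun t => t.Nodup) [] 5).any fun p =>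
    match p with
    | [a, b, c, d, v] => p.Nodup && decide (l.filter (· ≠ v) ~r [a, b, a, c, b, d, c, d])
    | _ => false

lemma hasPath_of_mem : (extendWord (fun t => countLe t && edgeSimple t) [(2 : Fin 5), 1, 0] 7).all
    hasPath := by
  decide +kernel

lemma path_rigid_aux : (extendWord countLe [(0 : Fin 4)] 7).all fun l =>
    !(decide (∀ u v, u ≠ v → (Alt [(0 : Fin 4), 1, 0, 2, 1, 3, 2, 3] u v ↔ Alt l u v))) ||
      decide (SameCircuit [(0 : Fin 4), 1, 0, 2, 1, 3, 2, 3] l) := by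
  decide +kernel

lemma small_rigid_aux {n : ℕ} (hn : n < 3) :
    (extendWord countLe [(0 : Fin (n + 1))] (2 * n + 1)).all fun l =>
    (extendWord countLe [(0 : Fin (n + 1))] (2 * n + 1)).all fun l' =>
      !(decide (∀ u v, u ≠ v → (Alt l u v ↔ Alt l' u v))) ||
      !(decide (∀ u v : Fin (n + 1), u ≠ v → ∃ w, w ≠ u ∧ Alt l u w)) ||
      decide (SameCircuit l l') := by
  interval_cases n <;> decide +kernel

end Enumeration

section Transport

variable {W V : Type*} [DecidableEq W] [DecidableEq V]

lemma alt_map (f : W ↪ V) (l : List W) (u v : W) : Alt (l.map f) (f u) (f v) ↔ Alt l u v := by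
  unfold Alt
  rw [List.filter_map]
  have : ((fun x => decide (x = f u ∨ x = f v)) ∘ f) = fun x => decide (x = u ∨ x = v) := by
    ext x; simp [f.injective.eq_iff]
  rw [this, show [f u, f v, f u, f v] = [u, v, u, v].map f from rfl,
    show [f v, f u, f v, f u] = [v, u, v, u].map f from rfl,
    (List.map_injective_iff.2 f.injective).eq_iff, (List.map_injective_iff.2 f.injective).eq_iff]

omit [DecidableEq W] [DecidableEq V] in
lemma SameCircuit.map (f : W → V) {l l' : List W} (h : SameCircuit l l') :
    SameCircuit (l.map f) (l'.map f) := by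
  rcases h with h | h
  · exact .inl (h.map f)
  · exact .inr (by rw [← List.map_reverse]; exact h.map f)

variable [Fintype W]

omit [DecidableEq W] [DecidableEq V] in
lemma exists_map_eq {f : W ↪ V} {l : List V} (h : ∀ v ∈ l, v ∈ Finset.univ.map f) :
    ∃ L : List W, l = L.map f := by
  induction l with
  | nil => exact ⟨[], rfl⟩
  | cons a l ih =>
    obtain ⟨L, rfl⟩ := ih fun v hv => h v (List.mem_cons_of_mem _ hv)
    obtain ⟨x, -, rfl⟩ := Finset.mem_map.1 (h a List.mem_cons_self)
    exact ⟨x :: L, rfl⟩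

lemma IsDoubleWord.of_map {f : W ↪ V} {l : List W}
    (h : IsDoubleWord (Finset.univ.map f) (l.map f)) : IsDoubleWord Finset.univ l where
  count v _ := by
    rw [← h.count (f v) (by simp), List.count_map_of_injective _ _ f.injective]
  mem v _ := Finset.mem_univ v

lemma IsRigid.map (f : W ↪ V) {l : List W} (h : IsRigid Finset.univ l) :
    IsRigid (Finset.univ.map f) (l.map f) := by
  intro l' hl' hs
  obtain ⟨L', rfl⟩ := exists_map_eq hl'.mem
  refine (h L' hl'.of_map fun u v huv => ?_).map f
  rw [← alt_map f, ← alt_map f]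
  exact hs _ _ (f.injective.ne huv)

omit [DecidableEq W] [DecidableEq V] [Fintype W] in
lemma linEdges_map (f : W → V) (l : List W) :
    linEdges (l.map f) = (linEdges l).map (Prod.map f f) := by
  induction l with
  | nil => rfl
  | cons a l ih =>
    rw [List.map_cons, linEdges, ih, linEdges]
    cases l <;> simp [joint]

end Transport

section BaseCases

lemma isDoubleWord_rotate_zero {n : ℕ} {l : List (Fin (n + 1))}
    (h : IsDoubleWord Finset.univ l) :
    ∃ l' ∈ extendWord countLe [(0 : Fin (n + 1))] (2 * n + 1), l ~r l' := by
  obtain ⟨A, B, hr, -, -⟩ := exists_sections (h.count 0 (Finset.mem_univ _))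
  have hr' : l ~r (A ++ 0 :: B) ++ [0] := hr.trans
    (by simpa using List.isRotated_append (l := [0]) (l' := A ++ 0 :: B))
  have h' := h.perm hr'.perm
  refine ⟨_, ?_, hr'⟩
  have := mem_extendWord (P := countLe) countLe_of_cons [0] (A ++ 0 :: B) h'.countLe
  have hl := h'.length
  rw [List.length_append] at hl
  simp only [List.length_singleton, Finset.card_univ, Fintype.card_fin] at hl
  rwa [show (A ++ 0 :: B).length = 2 * n + 1 by omega] at this

lemma isRigid_path : IsRigid Finset.univ [(0 : Fin 4), 1, 0, 2, 1, 3, 2, 3] := by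
  intro l hl hs
  obtain ⟨l', hl', hr⟩ := isDoubleWord_rotate_zero hl
  have := List.all_eq_true.1 path_rigid_aux l' hl'
  have hs' := hs.trans (sameAlt_of_isRotated hr)
  simp only [Bool.or_eq_true, Bool.not_eq_true', decide_eq_false_iff_not, decide_eq_true_eq] at this
  exact (this.resolve_left fun h => h fun u v huv => hs' u v huv).trans (.inl hr.symm)

lemma isRigid_of_card_le_three {n : ℕ} (hn : n < 3) {l : List (Fin (n + 1))}
    (h : IsDoubleWord Finset.univ l)
    (hc : ∀ u v : Fin (n + 1), u ≠ v → ∃ w, w ≠ u ∧ Alt l u w) : IsRigid Finset.univ l := by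
  intro l' hl' hs
  obtain ⟨m, hm, hr⟩ := isDoubleWord_rotate_zero h
  obtain ⟨m', hm', hr'⟩ := isDoubleWord_rotate_zero hl'
  have := List.all_eq_true.1 (List.all_eq_true.1 (small_rigid_aux hn) m hm) m' hm'
  have h1 := sameAlt_of_isRotated hr
  have hs' := h1.symm.trans (hs.trans (sameAlt_of_isRotated hr'))
  simp only [Bool.or_eq_true, Bool.not_eq_true', decide_eq_false_iff_not,
    decide_eq_true_eq] at this
  rcases this with (h2 | h2) | h2
  · exact absurd (fun u v huv => hs' u v huv) h2
  · refine absurd (fun u v huv => ?_) h2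
    obtain ⟨w, hw, ha⟩ := hc u v huv
    exact ⟨w, hw, (h1 u w hw.symm).1 ha⟩
  · exact (SameCircuit.trans (.inl hr) h2).trans (.inl hr'.symm)

lemma isRigid_of_hasPath {l : List (Fin 5)} (h : IsPrimeWord Finset.univ l) (hp : hasPath l) :
    IsRigid Finset.univ l := by
  simp only [hasPath, List.any_eq_true] at hp
  obtain ⟨p, -, hp⟩ := hp
  split at hp
  · rename_i a b c d v
    simp only [Bool.and_eq_true, decide_eq_true_eq] at hp
    obtain ⟨hnd, hr⟩ := hp
    obtain ⟨A, B, hr', hA, hB⟩ := exists_sections (h.count v (Finset.mem_univ v))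
    refine IsRigid.isRotated ?_ hr'.symm
    refine IsRigid.of_del (by simp) (h.isRotated hr') hA hB ?_
    have hf : (v :: A ++ v :: B).filter (· ≠ v) = A ++ B := by
      simp only [List.filter_append]
      rw [List.filter_cons_of_neg (by simp), List.filter_cons_of_neg (by simp),
        List.filter_eq_self.2, List.filter_eq_self.2]
      · intro x hx; simp; rintro rfl; exact hB hx
      · intro x hx; simp; rintro rfl; exact hA hx
    have hr'' : (l.filter (· ≠ v)) ~r (A ++ B) := by
      obtain ⟨X, Y, rfl, h2⟩ := exists_append_of_isRotated hr'
      rw [← hf, h2, List.filter_append, List.filter_append]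
      exact List.isRotated_append
    refine IsRigid.isRotated ?_ (hr.symm.trans hr'')
    simp only [List.nodup_cons, List.mem_cons, List.not_mem_nil, or_false, not_or] at hnd
    let f : Fin 4 ↪ Fin 5 := ⟨![a, b, c, d], by
      intro i j hij
      fin_cases i <;> fin_cases j <;> simp at hij ⊢ <;> tauto⟩
    have := isRigid_path.map f
    rwa [show Finset.univ.map f = Finset.univ.erase v from ?_] at this
    refine Finset.eq_of_subset_of_card_le (fun x hx => ?_) (by simp)
    obtain ⟨i, -, rfl⟩ := Finset.mem_map.1 hx
    simp only [Finset.mem_erase, Finset.mem_univ, and_true]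
    fin_cases i <;> simp [f] <;> tauto
  · simp at hp

end BaseCases

section PrimeRigid

variable {V : Type*} [DecidableEq V]

omit [DecidableEq V] in
lemma cycEdges_map {W : Type*} (f : W → V) (l : List W) :
    cycEdges (l.map f) = (cycEdges l).map (Prod.map f f) := by
  rw [cycEdges, cycEdges, linEdges_map, List.map_append]
  congr 1
  simp only [joint, List.getLast?_map, List.head?_map]
  cases l.getLast? <;> cases l.head? <;> simp

lemma edgeCut_map {W : Type*} [DecidableEq W] (f : W ↪ V) (E : List (W × W)) (A : Finset W) :
    edgeCut (E.map (Prod.map f f)) (A.map f) = edgeCut E A := by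
  simp [edgeCut, Function.comp_def]

lemma IsPrimeWord.of_map {W : Type*} [DecidableEq W] [Fintype W] {f : W ↪ V} {l : List W}
    (h : IsPrimeWord (Finset.univ.map f) (l.map f)) : IsPrimeWord Finset.univ l where
  toIsDoubleWord := h.toIsDoubleWord.of_map
  cut A _ h1 h2 := by
    rw [← edgeCut_map f, ← cycEdges_map]
    refine h.cut _ (Finset.map_subset_map.2 (Finset.subset_univ A)) (by simpa) ?_
    rwa [← Finset.map_sdiff, Finset.card_map]

lemma IsPrimeWord.edgeSimple {n : ℕ} (hn : 4 ≤ n) {l : List (Fin n)}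
    (h : IsPrimeWord Finset.univ l) : edgeSimple l := by
  simp only [_root_.edgeSimple, List.all_eq_true, List.mem_finRange, decide_eq_true_eq,
    forall_const]
  intro i j
  have hle : edgeMul (linEdges l) i j ≤ edgeMul (cycEdges l) i j := by
    rw [cycEdges, edgeMul_append]; omega
  have hE := h.isPrimeEdgeList
  split_ifs with hij
  · subst hij
    rwa [hE.mul_self (by simpa) (Finset.mem_univ i)] at hle
  · exact hle.trans (hE.mul_le (by simpa) (Finset.mem_univ i) (Finset.mem_univ j))

lemma IsPrimeWord.isRigid_of_card_eq_five {S : Finset V} {l : List V} (h : IsPrimeWord S l)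
    (hS : S.card = 5) : IsRigid S l := by
  have hS' : 4 ≤ S.card := by omega
  obtain ⟨v, hv⟩ := Finset.card_pos.1 (show 0 < S.card by omega)
  obtain ⟨A, B, hr, hA, hB⟩ := exists_sections (h.count v hv)
  have h' := h.isRotated hr
  have hA0 := h'.ne_nil_of_sections hS'
  have hB0 := (h'.isRotated (isRotated_swap v A B)).ne_nil_of_sections hS'
  have hN := h'.isNeighborList_sections hS' hA hB (List.head?_eq_some_head hA0)
    (List.getLast?_eq_some_getLast hA0) (List.head?_eq_some_head hB0)
    (List.getLast?_eq_some_getLast hB0)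
  have hnd := hN.nodup
  obtain ⟨A', ha⟩ : ∃ A', A = A' ++ [A.getLast hA0] :=
    ⟨_, (List.dropLast_append_getLast hA0).symm⟩
  obtain ⟨B', hb⟩ : ∃ B', B = B.head hB0 :: B' := ⟨_, (List.cons_head_tail hB0).symm⟩
  have haA := List.getLast_mem hA0
  have hbB := List.head_mem hB0
  generalize A.getLast hA0 = a at *
  generalize B.head hB0 = b at *
  simp only [List.nodup_cons, List.mem_cons, List.not_mem_nil, or_false, not_or] at hnd
  have hr' : l ~r (B' ++ v :: A') ++ [a, v, b] := by
    refine hr.trans ?_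
    rw [ha, hb]
    simpa using List.isRotated_append (l := v :: A' ++ [a, v, b]) (l' := B')
  have haS : a ∈ S := h'.mem a (by simp [haA])
  have hbS : b ∈ S := h'.mem b (by simp [hbB])
  obtain ⟨p, q, hpq, hpqS⟩ := Finset.card_eq_two.1 (show (S \ {b, v, a}).card = 2 by
    rw [Finset.card_sdiff_of_subset (by simp [Finset.insert_subset_iff, *]),
      Finset.card_eq_three.2 ⟨b, v, a, by tauto, by tauto, by tauto, rfl⟩]
    omega)
  have hp : p ∈ S \ {b, v, a} := by simp [hpqS]
  have hq : q ∈ S \ {b, v, a} := by simp [hpqS]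
  simp only [Finset.mem_sdiff, Finset.mem_insert, Finset.mem_singleton, not_or] at hp hq
  let f : Fin 5 ↪ V := ⟨![b, v, a, p, q], by
    intro i j hij
    fin_cases i <;> fin_cases j <;> simp at hij ⊢ <;> grind⟩
  have hf : Finset.univ.map f = S := by
    refine Finset.eq_of_subset_of_card_le (fun x hx => ?_) (by simp [hS])
    obtain ⟨i, -, rfl⟩ := Finset.mem_map.1 hx
    fin_cases i <;> simp [f] <;> tauto
  have h1 := h.isRotated hr'
  rw [← hf] at h1 ⊢
  refine IsRigid.isRotated ?_ hr'.symm
  obtain ⟨M, hM⟩ := exists_map_eq (f := f) (l := B' ++ v :: A') fun x hx =>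
    h1.mem x (List.mem_append_left _ hx)
  have hL : B' ++ v :: A' ++ [a, v, b] = (M ++ [2, 1, 0]).map f := by
    rw [hM, List.map_append]; rfl
  rw [hL] at h1 ⊢
  have h2 := h1.of_map
  refine IsRigid.map f (isRigid_of_hasPath h2 (List.all_eq_true.1 hasPath_of_mem _ ?_))
  have hlen := h2.toIsDoubleWord.length
  simp only [List.length_append, List.length_cons, List.length_nil, Finset.card_univ,
    Fintype.card_fin] at hlen
  rw [show 7 = M.length by omega]
  refine mem_extendWord (fun x s hs => ?_) _ _ ?_
  · rw [Bool.and_eq_true] at hs ⊢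
    exact ⟨countLe_of_cons x s hs.1, edgeSimple_of_cons x s hs.2⟩
  · rw [Bool.and_eq_true]
    exact ⟨h2.toIsDoubleWord.countLe, h2.edgeSimple (by norm_num)⟩

/-- A prime circuit is determined up to rotation and reflection by its alternating pairs. -/
lemma IsPrimeWord.isRigid {S : Finset V} {l : List V} (h : IsPrimeWord S l) (hS : 4 ≤ S.card) :
    IsRigid S l := by
  induction hn : S.card using Nat.strong_induction_on generalizing S l with
  | _ n ih =>
    obtain ⟨v, hv⟩ := Finset.card_pos.1 (show 0 < S.card by omega)
    obtain ⟨a, b, c, d, hN⟩ := h.isPrimeEdgeList.exists_neighbors hS hv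
    have h5 : 5 ≤ S.card := by
      rw [← show ([v, a, b, c, d].toFinset).card = 5 by
        rw [List.toFinset_card_of_nodup hN.nodup]; rfl]
      refine Finset.card_le_card fun x hx => ?_
      rcases List.mem_cons.1 (List.mem_toFinset.1 hx) with rfl | hx
      · exact hv
      · exact (hN.mul_mem x hx).1
    rcases h5.eq_or_lt with h5 | h6
    · exact h.isRigid_of_card_eq_five h5.symm
    refine h.isRigid_of_erase h6 fun v hv l hl => ?_
    have := Finset.card_erase_of_mem hv
    exact ih (n - 1) (by omega) hl (by omega) (by omega)

end PrimeRigid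

section Bridge

variable {V : Type*} [DecidableEq V]

lemma alt_of_sublist {l : List V} {u v a b c d : V} (h : Alt l u v)
    (hs : [a, b, c, d].Sublist l) (h4 : ∀ x ∈ [a, b, c, d], x = u ∨ x = v) :
    a = c ∧ b = d := by
  have h1 := hs.filter (fun x => x = u ∨ x = v)
  rw [List.filter_eq_self.2 (by simpa using h4)] at h1
  rcases h with h | h <;> rw [h] at h1 <;> have h2 := h1.eq_of_length (by simp) <;>
    simp only [List.cons.injEq, and_true] at h2 <;> exact ⟨by simp [h2], by simp [h2]⟩

lemma chordsAlternate_iff_alt {l : List V} {u v : V} (huv : u ≠ v) (hu : l.count u = 2)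
    (hv : l.count v = 2) : ChordsAlternate l u v ↔ Alt l u v := by
  constructor
  · intro h
    have hlen : (l.filter (fun x => x = u ∨ x = v)).length = 4 := by
      have h1 : ∀ m : List V, (m.filter (fun x => x = u ∨ x = v)).length
          = m.count u + m.count v := by
        intro m
        induction m with
        | nil => rfl
        | cons a m ih =>
          rw [List.filter_cons, List.count_cons, List.count_cons]
          by_cases h1 : a = u
          · subst h1; simp [-Bool.decide_or, huv, ih]; omega
          · by_cases h2 : a = v
            · subst h2; simp [-Bool.decide_or, h1, ih]; omega
            · simp [-Bool.decide_or, h1, h2, ih]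
      rw [h1, hu, hv]
    have hcu : (l.filter (fun x => x = u ∨ x = v)).count u = 2 := by
      rw [List.count_filter (by simp), hu]
    have hcv : (l.filter (fun x => x = u ∨ x = v)).count v = 2 := by
      rw [List.count_filter (by simp), hv]
    have hmem : ∀ x ∈ l.filter (fun x => x = u ∨ x = v), x = u ∨ x = v := by simp
    have hsub := List.filter_sublist (l := l) (p := fun x => x = u ∨ x = v)
    unfold Alt
    obtain ⟨a, b, c, d, he⟩ := List.length_eq_four.1 hlen
    rw [he] at hcu hcv hmem hsub ⊢
    obtain ⟨is, h1, h2⟩ := List.sublist_eq_map_getElem hsub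
    have hl : is.length = 4 := by simpa using (congrArg List.length h1).symm
    obtain ⟨p, q, r, s, rfl⟩ := List.length_eq_four.1 hl
    simp only [List.map_cons, List.map_nil, List.cons.injEq, and_true] at h1
    obtain ⟨rfl, rfl, rfl, rfl⟩ := h1
    simp only [List.pairwise_cons, List.mem_cons, List.not_mem_nil, or_false] at h2
    have hpq := h2.1 q (by simp)
    have hqr := h2.2.1 r (by simp)
    have hrs := h2.2.2.1 s (by simp)
    simp only [List.mem_cons, List.not_mem_nil, or_false, forall_eq_or_imp, forall_eq] at hmem
    have hvu := huv.symm
    obtain ⟨m1, m2, m3, m4⟩ := hmem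
    rcases m1 with e1 | e1 <;> rcases m2 with e2 | e2 <;> rcases m3 with e3 | e3 <;>
      rcases m4 with e4 | e4 <;> rw [e1, e2, e3, e4] at hcu ⊢ <;>
      simp [huv, hvu] at hcu ⊢ <;>
      first
        | exact absurd (h p q r s hpq hrs e1 e2 e3 e4) (by simp only [Fin.lt_def] at *; omega)
        | exact absurd (h p s q r (hpq.trans (hqr.trans hrs)) hqr e1 e4 e2 e3)
            (by simp only [Fin.lt_def] at *; omega)
        | exact absurd (h q r p s hqr (hpq.trans (hqr.trans hrs)) e2 e3 e1 e4)
            (by simp only [Fin.lt_def] at *; omega)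
        | exact absurd (h r s p q hrs hpq e3 e4 e1 e2) (by simp only [Fin.lt_def] at *; omega)
  · intro h i₁ i₂ j₁ j₂ hi hj hi₁ hi₂ hj₁ hj₂
    have key : ∀ p q r s : Fin l.length, p < q → q < r → r < s →
        (∀ x ∈ [l[p], l[q], l[r], l[s]], x = u ∨ x = v) → l[p] = l[r] ∧ l[q] = l[s] := by
      intro p q r s hpq hqr hrs h4
      refine alt_of_sublist h (List.map_getElem_sublist (is := [p, q, r, s]) ?_) h4
      simp [hpq, hqr, hrs, hpq.trans hqr, (hpq.trans hqr).trans hrs, hqr.trans hrs]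
    have hne : ∀ i j : Fin l.length, l.get i = u → l.get j = v → i ≠ j := by
      rintro i j h1 h2 rfl
      exact huv (h1.symm.trans h2)
    have n1 := hne i₁ j₁ hi₁ hj₁
    have n2 := hne i₁ j₂ hi₁ hj₂
    have n3 := hne i₂ j₁ hi₂ hj₁
    have n4 := hne i₂ j₂ hi₂ hj₂
    simp only [List.get_eq_getElem] at hi₁ hi₂ hj₁ hj₂
    simp only [Fin.getElem_fin] at key
    by_contra hcon
    have : (i₂ < j₁) ∨ (j₂ < i₁) ∨ (i₁ < j₁ ∧ j₂ < i₂) ∨ (j₁ < i₁ ∧ i₂ < j₂) := by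
      simp only [← Fin.val_inj, ne_eq, Fin.lt_def] at *
      omega
    rcases this with h1 | h1 | ⟨h1, h2⟩ | ⟨h1, h2⟩
    · have := key i₁ i₂ j₁ j₂ hi h1 hj (by simp [*])
      exact huv (hi₁.symm.trans (this.1.trans hj₁))
    · have := key j₁ j₂ i₁ i₂ hj h1 hi (by simp [*])
      exact huv (hi₁.symm.trans (this.1.symm.trans hj₁))
    · have := key i₁ j₁ j₂ i₂ h1 hj h2 (by simp [*])
      exact huv (hi₁.symm.trans (this.1.trans hj₂))
    · have := key j₁ i₁ i₂ j₂ h1 hi h2 (by simp [*])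
      exact huv (hi₂.symm.trans (this.1.symm.trans hj₁))

end Bridge

section Splits

variable {V : Type*} [DecidableEq V]

lemma exists_block (P : Finset V) (s : Prop) (l : List V) (hl : ∀ x ∈ l.head?, (x ∈ P ↔ s)) :
    ∃ b r, l = b ++ r ∧ (∀ y ∈ b, (y ∈ P ↔ s)) ∧
      ∀ y ∈ r.head?, ¬ (y ∈ P ↔ s) ∧ edgeCut (linEdges r) P + 1 ≤ edgeCut (linEdges l) P := by
  induction l with
  | nil => exact ⟨[], [], rfl, by simp, by simp⟩
  | cons x l ih =>
    have hx : x ∈ P ↔ s := hl x (by simp)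
    cases l with
    | nil => exact ⟨[x], [], rfl, by simpa using hx, by simp⟩
    | cons y l =>
      by_cases hy : y ∈ P ↔ s
      · obtain ⟨b, r, h1, h2, h3⟩ := ih (by simpa using hy)
        refine ⟨x :: b, r, by rw [h1, List.cons_append], by simpa [hx] using h2, fun z hz => ?_⟩
        refine ⟨(h3 z hz).1, (h3 z hz).2.trans ?_⟩
        rw [show linEdges (x :: y :: l) = joint [x] (y :: l) ++ linEdges (y :: l) from rfl,
          edgeCut_append]
        exact Nat.le_add_left _ _
      · refine ⟨[x], y :: l, rfl, by simpa using hx, fun z hz => ?_⟩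
        obtain rfl : y = z := by simpa using hz
        refine ⟨hy, ?_⟩
        rw [show linEdges (x :: y :: l) = joint [x] (y :: l) ++ linEdges (y :: l) from rfl,
          edgeCut_append]
        have : ¬ (x ∈ P ↔ y ∈ P) := by rw [hx]; tauto
        simp [joint, this, add_comm]

lemma exists_four_blocks {P : Finset V} {l : List V} (hl : ∀ x ∈ l.head?, x ∈ P)
    (hc : edgeCut (linEdges l) P ≤ 4) :
    ∃ c₁ c₂ c₃ c₄, l ~r c₁ ++ c₂ ++ c₃ ++ c₄ ∧ (∀ x ∈ c₁, x ∈ P) ∧ (∀ x ∈ c₂, x ∉ P) ∧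
      (∀ x ∈ c₃, x ∈ P) ∧ (∀ x ∈ c₄, x ∉ P) := by
  obtain ⟨b₁, r₁, rfl, h1, k1⟩ := exists_block P True l (by simpa using hl)
  obtain ⟨b₂, r₂, rfl, h2, k2⟩ := exists_block P False r₁ (fun y hy => by
    simpa using (k1 y hy).1)
  obtain ⟨b₃, r₃, rfl, h3, k3⟩ := exists_block P True r₂ (fun y hy => by
    simpa using (k2 y hy).1)
  obtain ⟨b₄, r₄, rfl, h4, k4⟩ := exists_block P False r₃ (fun y hy => by
    simpa using (k3 y hy).1)
  obtain ⟨b₅, r₅, rfl, h5, k5⟩ := exists_block P True r₄ (fun y hy => by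
    simpa using (k4 y hy).1)
  have hr : r₅ = [] := by
    by_contra hr
    have hd : ∀ m : List V, m ≠ [] → ∃ x, x ∈ m.head? :=
      fun m hm => ⟨m.head hm, List.head?_eq_some_head hm⟩
    obtain ⟨x₅, hx₅⟩ := hd r₅ hr
    obtain ⟨x₄, hx₄⟩ := hd (b₅ ++ r₅) (by simp [hr])
    obtain ⟨x₃, hx₃⟩ := hd (b₄ ++ (b₅ ++ r₅)) (by simp [hr])
    obtain ⟨x₂, hx₂⟩ := hd (b₃ ++ (b₄ ++ (b₅ ++ r₅))) (by simp [hr])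
    obtain ⟨x₁, hx₁⟩ := hd (b₂ ++ (b₃ ++ (b₄ ++ (b₅ ++ r₅)))) (by simp [hr])
    have := (k1 x₁ hx₁).2
    have := (k2 x₂ hx₂).2
    have := (k3 x₃ hx₃).2
    have := (k4 x₄ hx₄).2
    have := (k5 x₅ hx₅).2
    omega
  subst hr
  simp only [iff_true, iff_false] at h1 h2 h3 h4 h5
  refine ⟨b₅ ++ b₁, b₂, b₃, b₄, ?_, ?_, h2, h3, h4⟩
  · simpa using List.isRotated_append (l := b₁ ++ (b₂ ++ (b₃ ++ b₄))) (l' := b₅)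
  · intro x hx
    exact (List.mem_append.1 hx).elim (h5 x) (h1 x)

lemma alt_blocks {P : Finset V} {c₁ c₂ c₃ c₄ : List V} (h₁ : ∀ x ∈ c₁, x ∈ P)
    (h₂ : ∀ x ∈ c₂, x ∉ P) (h₃ : ∀ x ∈ c₃, x ∈ P) (h₄ : ∀ x ∈ c₄, x ∉ P) {u v : V}
    (hu : u ∈ P) (hv : v ∉ P) (hcu : (c₁ ++ c₂ ++ c₃ ++ c₄).count u = 2)
    (hcv : (c₁ ++ c₂ ++ c₃ ++ c₄).count v = 2) :
    Alt (c₁ ++ c₂ ++ c₃ ++ c₄) u v ↔ c₁.count u = 1 ∧ c₂.count v = 1 := by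
  have huv : u ≠ v := by rintro rfl; exact hv hu
  have n1 : v ∉ c₁ := fun h => hv (h₁ _ h)
  have n2 : u ∉ c₂ := fun h => h₂ _ h hu
  have n3 : v ∉ c₃ := fun h => hv (h₃ _ h)
  have n4 : u ∉ c₄ := fun h => h₄ _ h hu
  simp only [List.count_append, List.count_eq_zero.2 n1, List.count_eq_zero.2 n2,
    List.count_eq_zero.2 n3, List.count_eq_zero.2 n4] at hcu hcv
  have e : ∀ c : List V, v ∉ c → c.filter (fun x => x = u ∨ x = v)
      = List.replicate (c.count u) u := fun c hc => by
    rw [← filter_or_of_notMem hc]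
    exact List.filter_congr fun x _ => by simp [or_comm]
  unfold Alt
  rw [List.filter_append, List.filter_append, List.filter_append, e _ n1, e _ n3,
    filter_or_of_notMem n2, filter_or_of_notMem n4]
  have h3 : c₃.count u = 2 - c₁.count u := by omega
  have h4 : c₄.count v = 2 - c₂.count v := by omega
  rw [h3, h4]
  rcases (show c₁.count u = 0 ∨ c₁.count u = 1 ∨ c₁.count u = 2 by omega) with h | h | h <;>
  rcases (show c₂.count v = 0 ∨ c₂.count v = 1 ∨ c₂.count v = 2 by omega) with h' | h' | h' <;>
  rw [h, h'] <;> simp [List.replicate, huv, huv.symm]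

variable [Fintype V]

lemma IsChordModel.isDoubleWord {G : SimpleGraph V} {w : List V} (h : IsChordModel G w) :
    IsDoubleWord Finset.univ w where
  count := h.1
  mem v _ := Finset.mem_univ v

lemma IsChordModel.adj_iff {G : SimpleGraph V} {w : List V} (h : IsChordModel G w) {u v : V}
    (huv : u ≠ v) : G.Adj u v ↔ Alt w u v := by
  rw [h.2.2 u (Finset.mem_univ u) v (Finset.mem_univ v) huv,
    chordsAlternate_iff_alt huv (h.1 u (Finset.mem_univ u)) (h.1 v (Finset.mem_univ v))]

omit [DecidableEq V] [Fintype V] in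
lemma exists_adj_of_connected {G : SimpleGraph V} (hconn : G.Connected) {P : Finset V} {u v : V}
    (hu : u ∈ P) (hv : v ∉ P) : ∃ x ∈ P, ∃ y ∉ P, G.Adj x y := by
  obtain ⟨p⟩ := hconn.preconnected u v
  obtain ⟨d, -, h1, h2⟩ := p.exists_boundary_dart (P : Set V) (by simpa) (by simpa)
  exact ⟨d.fst, by simpa using h1, d.snd, by simpa using h2, d.adj⟩

/-- A chord model of a connected graph without non-trivial splits is a prime circuit. -/
lemma IsChordModel.isPrimeWord {G : SimpleGraph V} (hconn : G.Connected)
    (hnosplit : ∀ A αA B αB : Finset V, IsSplit G A αA B αB →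
      ¬ (2 ≤ (A ∪ αA).card ∧ 2 ≤ (B ∪ αB).card))
    {w : List V} (h : IsChordModel G w) : IsPrimeWord Finset.univ w := by
  refine ⟨h.isDoubleWord, fun P _ h1 h2 => ?_⟩
  by_contra! hcut
  have hcut' : edgeCut (cycEdges w) P ≤ 4 := by
    have : Even (edgeCut (cycEdges w) P) := edgeCut_even fun x _ => by
      rw [edgeDeg_cycEdges]; exact even_two_mul _
    grind
  obtain ⟨p, hp⟩ := Finset.card_pos.1 (show 0 < P.card by omega)
  obtain ⟨q, hq⟩ := Finset.card_pos.1 (show 0 < (Finset.univ \ P).card by omega)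
  obtain ⟨X, Y, hr, -, -⟩ := exists_sections (h.1 p (Finset.mem_univ p))
  obtain ⟨c₁, c₂, c₃, c₄, hr', h₁, h₂, h₃, h₄⟩ := exists_four_blocks (P := P)
    (l := p :: X ++ p :: Y) (by simpa using hp) (by
      rw [edgeCut_cycEdges_isRotated hr, cycEdges, edgeCut_append] at hcut'
      omega)
  have hrot := hr.trans hr'
  have hd := h.isDoubleWord.perm hrot.perm
  have hadj : ∀ u ∈ P, ∀ v ∉ P, (G.Adj u v ↔ c₁.count u = 1 ∧ c₂.count v = 1) := by
    intro u hu v hv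
    have huv : u ≠ v := by rintro rfl; exact hv hu
    rw [h.adj_iff huv, sameAlt_of_isRotated hrot u v huv]
    exact alt_blocks h₁ h₂ h₃ h₄ hu hv (hd.count u (Finset.mem_univ u))
      (hd.count v (Finset.mem_univ v))
  obtain ⟨x, hx, y, hy, hxy⟩ := exists_adj_of_connected hconn hp (by simpa using hq)
  have hxy' := (hadj x hx y hy).1 hxy
  have e1 : P.filter (fun u => c₁.count u = 1) ∪ P.filter (fun u => ¬ c₁.count u = 1) = P :=
    Finset.filter_union_filter_not_eq _ _
  have e2 : (Finset.univ \ P).filter (fun u => c₂.count u = 1) ∪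
      (Finset.univ \ P).filter (fun u => ¬ c₂.count u = 1) = Finset.univ \ P :=
    Finset.filter_union_filter_not_eq _ _
  refine hnosplit (P.filter fun u => c₁.count u = 1) (P.filter fun u => ¬ c₁.count u = 1)
    ((Finset.univ \ P).filter fun u => c₂.count u = 1)
    ((Finset.univ \ P).filter fun u => ¬ c₂.count u = 1) ?_ ⟨by rwa [e1], by rwa [e2]⟩
  refine ⟨⟨x, by simp [hx, hxy']⟩, ⟨y, by simp [hy, hxy']⟩, Finset.disjoint_filter_filter_not _ _ _,
    ?_, ?_, ?_, ?_, Finset.disjoint_filter_filter_not _ _ _, ?_, ?_, ?_, ?_⟩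
  · exact Finset.disjoint_filter_filter Finset.disjoint_sdiff
  · exact Finset.disjoint_filter_filter Finset.disjoint_sdiff
  · exact Finset.disjoint_filter_filter Finset.disjoint_sdiff
  · exact Finset.disjoint_filter_filter Finset.disjoint_sdiff
  · rw [e1, Finset.union_assoc, e2]; simp
  · intro a ha b hb
    simp only [Finset.mem_filter, Finset.mem_sdiff, Finset.mem_univ, true_and] at ha hb
    exact (hadj a ha.1 b hb.1).2 ⟨ha.2, hb.2⟩
  · intro u hu v hv huv
    rw [e2] at hv
    simp only [Finset.mem_filter, Finset.mem_sdiff, Finset.mem_univ, true_and] at hu hv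
    exact hu.2 ((hadj u hu.1 v hv).1 huv).1
  · intro u hu v hv huv
    rw [e1] at hv
    simp only [Finset.mem_filter, Finset.mem_sdiff, Finset.mem_univ, true_and] at hu hv
    exact hu.2 ((hadj v hv u hu.1).1 huv.symm).2

lemma IsChordModel.isRigid {G : SimpleGraph V} (hconn : G.Connected)
    (hnosplit : ∀ A αA B αB : Finset V, IsSplit G A αA B αB →
      ¬ (2 ≤ (A ∪ αA).card ∧ 2 ≤ (B ∪ αB).card))
    {w : List V} (h : IsChordModel G w) : IsRigid Finset.univ w := by
  by_cases hV : 4 ≤ Fintype.card V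
  · exact (h.isPrimeWord hconn hnosplit).isRigid hV
  have := hconn.nonempty
  obtain ⟨n, hn⟩ := Nat.exists_eq_succ_of_ne_zero (Fintype.card_ne_zero (α := V))
  let f : Fin (n + 1) ↪ V := (Fintype.equivFinOfCardEq hn).symm.toEmbedding
  have hf : Finset.univ.map f = Finset.univ := Finset.map_univ_equiv _
  have hd := h.isDoubleWord
  rw [← hf] at hd ⊢
  obtain ⟨L, rfl⟩ := exists_map_eq hd.mem
  refine IsRigid.map f (isRigid_of_card_le_three (by omega) hd.of_map fun u v huv => ?_)
  obtain ⟨x, hx, y, hy, hxy⟩ := exists_adj_of_connected hconn (P := {f u})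
    (Finset.mem_singleton_self _) (v := f v) (by simpa using huv.symm)
  obtain rfl := Finset.mem_singleton.1 hx
  obtain ⟨y, rfl⟩ := (Fintype.equivFinOfCardEq hn).symm.surjective y
  have hyu : y ≠ u := by rintro rfl; exact hxy.ne rfl
  refine ⟨y, hyu, ?_⟩
  rw [← alt_map f]
  exact (h.adj_iff hxy.ne).1 hxy

end Splits

/-- If a connected graph `G` admits a chord model and has no non-trivial split,
then `G` has, up to rotation, exactly two chord models, one being the reflection
of the other: any two chord models `w, w'` of `G` satisfy that `w'` is a rotation
of `w` or a rotation of the reflection of `w`. -/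
theorem chord_models_unique_of_no_nontrivial_split
    {V : Type*} [Fintype V] [DecidableEq V] (G : SimpleGraph V)
    (hconn : G.Connected)
    (hex : ∃ m : List V, IsChordModel G m)
    (hnosplit : ∀ A αA B αB : Finset V, IsSplit G A αA B αB →
      ¬ (2 ≤ (A ∪ αA).card ∧ 2 ≤ (B ∪ αB).card))
    (w w' : List V) (hw : IsChordModel G w) (hw' : IsChordModel G w') :
    (∃ r : ℕ, w' = w.rotate r) ∨ (∃ r : ℕ, w' = w.reverse.rotate r) := by
  rcases hw.isRigid hconn hnosplit w' hw'.isDoubleWord fun u v huv => by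
    rw [← hw.adj_iff huv, ← hw'.adj_iff huv] with ⟨r, hr⟩ | ⟨r, hr⟩
  · exact .inl ⟨r, hr.symm⟩
  · exact .inr ⟨r, hr.symm⟩
end

section
/- Let G be a connected finite simple graph, let a be a vertex of G, and let D_1, …, D_k with k ≥ 2 be the vertex sets of the connected components of G − a. For each i let G_i be the subgraph of G induced on {a} ∪ D_i. Suppose that for every i ∈ [k], a τ_i a τ'_i is a chord model of G_i (where τ_i and τ'_i are the two segments determined by the two occurrences of a). Let i_1, …, i_k be a permutation of [k] and let μ_i, μ'_i be words with {μ_i, μ'_i} = {τ_i, τ'_i} for every i. Then the cyclic word a μ_{i_1} ⋯ μ_{i_k} a μ'_{i_k} ⋯ μ'_{i_1} is a chord model of G. -/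
theorem chordsAlternate_iff_getElem? {V : Type*} (l : List V) (u v : V) :
    ChordsAlternate l u v ↔ ∀ i₁ i₂ j₁ j₂ : ℕ, i₁ < i₂ → j₁ < j₂ →
      l[i₁]? = some u → l[i₂]? = some u → l[j₁]? = some v → l[j₂]? = some v →
      ((i₁ < j₁ ∧ j₁ < i₂ ∧ i₂ < j₂) ∨ (j₁ < i₁ ∧ i₁ < j₂ ∧ j₂ < i₂)) := by
  constructor
  · intro h i₁ i₂ j₁ j₂ hi hj h₁ h₂ h₃ h₄
    obtain ⟨a₁, e₁⟩ := List.getElem?_eq_some_iff.1 h₁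
    obtain ⟨a₂, e₂⟩ := List.getElem?_eq_some_iff.1 h₂
    obtain ⟨a₃, e₃⟩ := List.getElem?_eq_some_iff.1 h₃
    obtain ⟨a₄, e₄⟩ := List.getElem?_eq_some_iff.1 h₄
    exact h ⟨i₁, a₁⟩ ⟨i₂, a₂⟩ ⟨j₁, a₃⟩ ⟨j₂, a₄⟩ hi hj e₁ e₂ e₃ e₄
  · intro h i₁ i₂ j₁ j₂ hi hj h₁ h₂ h₃ h₄
    exact h i₁ i₂ j₁ j₂ hi hj (List.getElem?_eq_some_iff.2 ⟨i₁.2, h₁⟩)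
      (List.getElem?_eq_some_iff.2 ⟨i₂.2, h₂⟩) (List.getElem?_eq_some_iff.2 ⟨j₁.2, h₃⟩)
      (List.getElem?_eq_some_iff.2 ⟨j₂.2, h₄⟩)

/-- Deleting a letter other than `u` and `v` does not affect alternation. -/
theorem chordsAlternate_append_cons_iff {V : Type*} {u v x : V} (hu : x ≠ u) (hv : x ≠ v)
    (p s : List V) : ChordsAlternate (p ++ x :: s) u v ↔ ChordsAlternate (p ++ s) u v := by
  simp only [chordsAlternate_iff_getElem?]
  have insert_idx : ∀ i : ℕ,
      (p ++ x :: s)[if i < p.length then i else i + 1]? = (p ++ s)[i]? := by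
    intro i
    split_ifs with h
    · rw [List.getElem?_append_left h, List.getElem?_append_left h]
    · rw [List.getElem?_append_right (by omega), List.getElem?_append_right (by omega),
        show i + 1 - p.length = (i - p.length) + 1 by omega, List.getElem?_cons_succ]
  have delete_idx : ∀ (i : ℕ) (y : V), x ≠ y → (p ++ x :: s)[i]? = some y →
      i ≠ p.length ∧ (p ++ s)[if i < p.length then i else i - 1]? = some y := by
    intro i y hy h
    have hne : i ≠ p.length := by
      rintro rfl
      simp [hy] at h
    refine ⟨hne, ?_⟩
    rw [← insert_idx, ← h]
    congr 1
    split_ifs <;> omega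
  constructor
  · intro h i₁ i₂ j₁ j₂ hi hj h₁ h₂ h₃ h₄
    rw [← insert_idx] at h₁ h₂ h₃ h₄
    have := h _ _ _ _ (by split_ifs <;> omega) (by split_ifs <;> omega) h₁ h₂ h₃ h₄
    split_ifs at this <;> omega
  · intro h i₁ i₂ j₁ j₂ hi hj h₁ h₂ h₃ h₄
    obtain ⟨n₁, h₁⟩ := delete_idx _ _ hu h₁
    obtain ⟨n₂, h₂⟩ := delete_idx _ _ hu h₂
    obtain ⟨n₃, h₃⟩ := delete_idx _ _ hv h₃
    obtain ⟨n₄, h₄⟩ := delete_idx _ _ hv h₄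
    have := h _ _ _ _ (by split_ifs <;> omega) (by split_ifs <;> omega) h₁ h₂ h₃ h₄
    split_ifs at this <;> omega

theorem chordsAlternate_append_filter_iff {V : Type*} [DecidableEq V] (u v : V)
    (s p : List V) :
    ChordsAlternate (p ++ s.filter (fun x => x = u ∨ x = v)) u v ↔
      ChordsAlternate (p ++ s) u v := by
  induction s generalizing p with
  | nil => simp
  | cons x s ih =>
    by_cases hx : x = u ∨ x = v
    · rw [List.filter_cons_of_pos (by simpa using hx)]
      simpa using ih (p ++ [x])
    · rw [List.filter_cons_of_neg (by simpa using hx), ih]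
      push Not at hx
      rw [chordsAlternate_append_cons_iff hx.1 hx.2]

theorem chordsAlternate_comm {V : Type*} (l : List V) (u v : V) :
    ChordsAlternate l u v ↔ ChordsAlternate l v u := by
  constructor <;> intro h i₁ i₂ j₁ j₂ hi hj h₁ h₂ h₃ h₄ <;>
    exact (h j₁ j₂ i₁ i₂ hj hi h₃ h₄ h₁ h₂).symm

theorem chordsAlternate_quad {V : Type*} {u v : V} (huv : u ≠ v) :
    ChordsAlternate [u, v, u, v] u v := by
  rw [chordsAlternate_iff_getElem?]
  have hu : ∀ i : ℕ, [u, v, u, v][i]? = some u → i = 0 ∨ i = 2 := by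
    rintro (_ | _ | _ | _ | i) <;> simp [huv.symm]
  have hv : ∀ i : ℕ, [u, v, u, v][i]? = some v → i = 1 ∨ i = 3 := by
    rintro (_ | _ | _ | _ | i) <;> simp [huv]
  intro i₁ i₂ j₁ j₂ hi hj h₁ h₂ h₃ h₄
  have := hu _ h₁
  have := hu _ h₂
  have := hv _ h₃
  have := hv _ h₄
  omega

/-- Two letters that occur twice alternate precisely when the subword they span does. -/
theorem chordsAlternate_iff_filter {V : Type*} [DecidableEq V] {l : List V} {u v : V}
    (huv : u ≠ v) (hu : l.count u = 2) (hv : l.count v = 2) :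
    ChordsAlternate l u v ↔
      l.filter (fun x => x = u ∨ x = v) = [u, v, u, v] ∨
      l.filter (fun x => x = u ∨ x = v) = [v, u, v, u] := by
  have key := chordsAlternate_append_filter_iff u v l []
  simp only [List.nil_append] at key
  rw [← key]
  have hmu : (l.filter (fun x => x = u ∨ x = v)).count u = 2 := by
    rw [List.count_filter (by simp), hu]
  have hmv : (l.filter (fun x => x = u ∨ x = v)).count v = 2 := by
    rw [List.count_filter (by simp), hv]
  have hmem : ∀ x ∈ l.filter (fun x => x = u ∨ x = v), x = u ∨ x = v := by
    intro x hx
    simpa using (List.mem_filter.1 hx).2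
  generalize l.filter (fun x => x = u ∨ x = v) = m at *
  constructor
  · intro h
    rw [chordsAlternate_iff_getElem?] at h
    have hlen : m.length = 4 := by
      have : ∀ m : List V, (∀ x ∈ m, x = u ∨ x = v) → m.length = m.count u + m.count v := by
        intro m
        induction m with
        | nil => simp
        | cons x m ih =>
          intro hm
          have := ih fun y hy => hm y (List.mem_cons_of_mem _ hy)
          rcases hm x List.mem_cons_self with rfl | rfl
          · simp [huv]; omega
          · simp [huv.symm]; omega
      rw [this m hmem, hmu, hmv]
    obtain ⟨w, x, y, z, rfl⟩ : ∃ w x y z, m = [w, x, y, z] := by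
      match m, hlen with
      | [w, x, y, z], _ => exact ⟨w, x, y, z, rfl⟩
    simp only [List.mem_cons, List.not_mem_nil, or_false, forall_eq_or_imp, forall_eq] at hmem
    have h₁ := h 0 1 2 3
    have h₂ := h 2 3 0 1
    have h₃ := h 0 3 1 2
    have h₄ := h 1 2 0 3
    obtain ⟨rfl | rfl, rfl | rfl, rfl | rfl, rfl | rfl⟩ := hmem <;>
      simp_all [List.count_cons]
  · rintro (rfl | rfl)
    · exact chordsAlternate_quad huv
    · exact (chordsAlternate_comm _ _ _).2 (chordsAlternate_quad huv.symm)

theorem alternating_append_comm {V : Type*} {u v : V} {s t : List V}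
    (h : s ++ t = [u, v, u, v]) : t ++ s = [u, v, u, v] ∨ t ++ s = [v, u, v, u] := by
  match s, h with
  | [], h => exact Or.inl (by simpa using h)
  | [_], h | [_, _], h | [_, _, _], h | [_, _, _, _], h =>
    simp only [List.cons_append, List.nil_append, List.cons.injEq] at h
    simp_all
  | _ :: _ :: _ :: _ :: _ :: _, h => simp at h

/-- Rotating a chord model to exchange its two halves yields a chord model. -/
theorem IsChordModelOn.append_comm {V : Type*} [DecidableEq V] {G : SimpleGraph V}
    {S : Finset V} {s t : List V} (h : IsChordModelOn G S (s ++ t)) :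
    IsChordModelOn G S (t ++ s) := by
  have hcount : ∀ x, (t ++ s).count x = (s ++ t).count x := fun x => by
    simp [Nat.add_comm]
  refine ⟨fun x hx => by rw [hcount, h.1 x hx], fun x hx => by rw [hcount, h.2.1 x hx], ?_⟩
  intro u hu v hv huv
  rw [h.2.2 u hu v hv huv, chordsAlternate_iff_filter huv (h.1 u hu) (h.1 v hv),
    chordsAlternate_iff_filter huv (by rw [hcount, h.1 u hu]) (by rw [hcount, h.1 v hv]),
    List.filter_append, List.filter_append]
  constructor
  · rintro (e | e)
    · exact alternating_append_comm e
    · exact (alternating_append_comm e).symm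
  · rintro (e | e)
    · exact alternating_append_comm e
    · exact (alternating_append_comm e).symm

theorem flatten_map_eq_nil {ι V : Type*} {L : List ι} {g : ι → List V}
    (h : ∀ j ∈ L, g j = []) : (L.map g).flatten = [] := by
  simpa [List.flatten_eq_nil_iff] using h

theorem flatten_map_eq_of_forall_ne {ι V : Type*} {L : List ι} (hL : L.Nodup) {i : ι}
    (hi : i ∈ L) {g : ι → List V} (h : ∀ j, j ≠ i → g j = []) :
    (L.map g).flatten = g i := by
  obtain ⟨A, B, rfl⟩ := List.append_of_mem hi
  have hAB := List.nodup_append.1 hL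
  have hA : ∀ j ∈ A, g j = [] := fun j hj => h j (hAB.2.2 j hj i List.mem_cons_self)
  have hB : ∀ j ∈ B, g j = [] := fun j hj =>
    h j fun e => (List.nodup_cons.1 hAB.2.1).1 (e ▸ hj)
  simp [flatten_map_eq_nil hA, flatten_map_eq_nil hB]

/-- Concatenating along `L` and against `L` a family supported on two indices nests them. -/
theorem flatten_map_pair {ι V : Type*} {L : List ι} (hL : L.Nodup) {i j : ι}
    (hi : i ∈ L) (hj : j ∈ L) (hij : i ≠ j) {g g' : ι → List V}
    (h : ∀ m, m ≠ i → m ≠ j → g m = [] ∧ g' m = []) :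
    ((L.map g).flatten = g i ++ g j ∧ (L.reverse.map g').flatten = g' j ++ g' i) ∨
    ((L.map g).flatten = g j ++ g i ∧ (L.reverse.map g').flatten = g' i ++ g' j) := by
  induction L with
  | nil => simp at hi
  | cons x L ih =>
    obtain ⟨hx, hL⟩ := List.nodup_cons.1 hL
    have tail : ∀ {p q : ι}, p ∉ L → q ∈ L → (∀ m, m ≠ p → m ≠ q → g m = [] ∧ g' m = []) →
        (L.map g).flatten = g q ∧ (L.reverse.map g').flatten = g' q := by
      intro p q hp hq h
      obtain ⟨A, B, rfl⟩ := List.append_of_mem hq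
      have hAB := List.nodup_append.1 hL
      have hA : ∀ m ∈ A, g m = [] ∧ g' m = [] := fun m hm =>
        h m (fun e => hp (by simp [← e, hm])) (hAB.2.2 m hm q List.mem_cons_self)
      have hB : ∀ m ∈ B, g m = [] ∧ g' m = [] := fun m hm =>
        h m (fun e => hp (by simp [← e, hm])) fun e => (List.nodup_cons.1 hAB.2.1).1 (e ▸ hm)
      have hA' : ∀ m ∈ A.reverse, g' m = [] := fun m hm => (hA m (List.mem_reverse.1 hm)).2
      have hB' : ∀ m ∈ B.reverse, g' m = [] := fun m hm => (hB m (List.mem_reverse.1 hm)).2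
      have e₁ := flatten_map_eq_nil hA'
      have e₂ := flatten_map_eq_nil hB'
      rw [List.map_reverse] at e₁ e₂
      simp [flatten_map_eq_nil fun m hm => (hA m hm).1,
        flatten_map_eq_nil fun m hm => (hB m hm).1, e₁, e₂]
    by_cases hxi : x = i
    · subst hxi
      have hjL : j ∈ L := (List.mem_cons.1 hj).resolve_left hij.symm
      obtain ⟨e₁, e₂⟩ := tail hx hjL h
      left
      rw [List.reverse_cons, List.map_append, List.flatten_append, e₂]
      simp [e₁]
    · by_cases hxj : x = j
      · subst hxj
        have hiL : i ∈ L := (List.mem_cons.1 hi).resolve_left hij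
        obtain ⟨e₁, e₂⟩ := tail hx hiL fun m h₁ h₂ => h m h₂ h₁
        right
        rw [List.reverse_cons, List.map_append, List.flatten_append, e₂]
        simp [e₁]
      · have hg := h x hxi hxj
        have := ih hL ((List.mem_cons.1 hi).resolve_left (Ne.symm hxi))
          ((List.mem_cons.1 hj).resolve_left (Ne.symm hxj))
        rw [List.reverse_cons, List.map_append, List.flatten_append, List.map_cons,
          List.flatten_cons]
        simpa [hg.1, hg.2] using this

/-- Nested pairs of blocks do not alternate. -/
theorem nested_not_alternating {V : Type*} [DecidableEq V] {u v : V} (huv : u ≠ v)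
    {s t s' t' : List V}
    (hs : ∀ x ∈ s, x = u) (hs' : ∀ x ∈ s', x = u) (ht : ∀ x ∈ t, x = v) (ht' : ∀ x ∈ t', x = v) :
    (s ++ t) ++ (t' ++ s') ≠ [u, v, u, v] ∧ (s ++ t) ++ (t' ++ s') ≠ [v, u, v, u] := by
  obtain ⟨n, rfl⟩ : ∃ n, s = List.replicate n u := ⟨_, List.eq_replicate_of_mem hs⟩
  obtain ⟨n', rfl⟩ : ∃ n, s' = List.replicate n u := ⟨_, List.eq_replicate_of_mem hs'⟩
  obtain ⟨m, rfl⟩ : ∃ n, t = List.replicate n v := ⟨_, List.eq_replicate_of_mem ht⟩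
  obtain ⟨m', rfl⟩ : ∃ n, t' = List.replicate n v := ⟨_, List.eq_replicate_of_mem ht'⟩
  have merge : (List.replicate n u ++ List.replicate m v) ++
      (List.replicate m' v ++ List.replicate n' u) =
      List.replicate n u ++ (List.replicate (m + m') v ++ List.replicate n' u) := by
    simp [List.append_assoc, ← List.replicate_append_replicate]
  rw [merge]
  generalize m + m' = r
  have ne_of_count : ∀ w : List V, w.count u = 2 → w.count v = 2 →
      w ≠ [u, u, v, v] → w ≠ [u, v, v, u] → w ≠ [v, v, u, u] →
      List.replicate n u ++ (List.replicate r v ++ List.replicate n' u) ≠ w := by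
    rintro w hu hv h₁ h₂ h₃ rfl
    have hn : n + n' = 2 := by simpa [List.count_replicate, huv.symm] using hu
    have hr : r = 2 := by simpa [List.count_replicate, huv] using hv
    subst hr
    obtain ⟨rfl, rfl⟩ | ⟨rfl, rfl⟩ | ⟨rfl, rfl⟩ :
        (n = 0 ∧ n' = 2) ∨ (n = 1 ∧ n' = 1) ∨ (n = 2 ∧ n' = 0) := by omega
    · exact h₃ rfl
    · exact h₂ rfl
    · exact h₁ rfl
  constructor <;> apply ne_of_count <;> simp [huv, huv.symm]

theorem chord_model_composition_articulation_point
    {V : Type*} [Fintype V] [DecidableEq V] (G : SimpleGraph V)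
    (hconn : G.Connected) (a : V)
    (k : ℕ) (hk : 2 ≤ k) (D : Fin k → Finset V)
    -- `D 0, …, D (k-1)` are the vertex sets of the connected components of `G - a`:
    (hDdisj : ∀ i j, i ≠ j → Disjoint (D i) (D j))
    (hDcover : Finset.univ.biUnion D = Finset.univ.erase a)
    (hDconn : ∀ i, (G.induce ((D i : Finset V) : Set V)).Connected)
    (hDsep : ∀ i j, i ≠ j → ∀ u ∈ D i, ∀ v ∈ D j, ¬ G.Adj u v)
    (τ τ' : Fin k → List V)
    (hmodels : ∀ i, IsChordModelOn G (insert a (D i)) (a :: τ i ++ a :: τ' i))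
    (σ : Equiv.Perm (Fin k)) (μ μ' : Fin k → List V)
    (hμ : ∀ i, (μ i = τ i ∧ μ' i = τ' i) ∨ (μ i = τ' i ∧ μ' i = τ i)) :
    IsChordModelOn G Finset.univ
      (a :: (List.ofFn (fun j => μ (σ j))).flatten ++
        a :: ((List.ofFn (fun j => μ' (σ j))).reverse).flatten) := by
  set L : List (Fin k) := (List.finRange k).map σ with hLdef
  have hL : L.Nodup := (List.nodup_finRange k).map σ.injective
  have hmemL : ∀ i, i ∈ L := fun i => by
    rw [hLdef, List.mem_map]
    exact ⟨σ.symm i, List.mem_finRange _, σ.apply_symm_apply i⟩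
  have hword : (a :: (List.ofFn (fun j => μ (σ j))).flatten ++
      a :: ((List.ofFn (fun j => μ' (σ j))).reverse).flatten) =
      a :: (L.map μ).flatten ++ a :: (L.reverse.map μ').flatten := by
    simp only [List.ofFn_eq_map, hLdef, List.map_reverse, List.map_map]
    rfl
  rw [hword]
  have hmodel : ∀ i, IsChordModelOn G (insert a (D i)) (a :: μ i ++ a :: μ' i) := by
    intro i
    rcases hμ i with ⟨h, h'⟩ | ⟨h, h'⟩ <;> rw [h, h']
    · exact hmodels i
    · exact (hmodels i).append_comm
  have hletters : ∀ i x, x ∈ μ i ∨ x ∈ μ' i → x ∈ D i := by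
    intro i x hx
    have hxa : x ≠ a := by
      rintro rfl
      have := (hmodel i).1 x (Finset.mem_insert_self _ _)
      have h₁ := List.count_pos_iff (a := x) (l := μ i)
      have h₂ := List.count_pos_iff (a := x) (l := μ' i)
      simp only [List.count_append, List.count_cons_self] at this
      rcases hx with hx | hx
      · have := h₁.2 hx
        omega
      · have := h₂.2 hx
        omega
    by_contra hxD
    have := (hmodel i).2.1 x (by simp [hxa, hxD])
    rw [List.count_eq_zero] at this
    apply this
    rcases hx with hx | hx <;> simp [hx]
  have hfilter_nil : ∀ (p : V → Bool) i, (∀ x ∈ D i, p x = false) →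
      (μ i).filter p = [] ∧ (μ' i).filter p = [] := by
    intro p i hp
    simp only [List.filter_eq_nil_iff, Bool.not_eq_true]
    exact ⟨fun x hx => hp x (hletters i x (.inl hx)), fun x hx => hp x (hletters i x (.inr hx))⟩
  have hword_filter : ∀ p : V → Bool,
      (a :: (L.map μ).flatten ++ a :: (L.reverse.map μ').flatten).filter p =
        [a].filter p ++ (L.map fun i => (μ i).filter p).flatten ++
          ([a].filter p ++ (L.reverse.map fun i => (μ' i).filter p).flatten) := by
    intro p
    have hcons : ∀ l : List V, (a :: l).filter p = [a].filter p ++ l.filter p := fun l => by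
      rw [← List.filter_append, List.singleton_append]
    rw [List.filter_append, hcons, hcons (L.reverse.map μ').flatten]
    simp only [List.filter_flatten, List.map_map, Function.comp_def]
  have hlocal : ∀ (p : V → Bool) i, (∀ j, j ≠ i → ∀ x ∈ D j, p x = false) →
      (a :: (L.map μ).flatten ++ a :: (L.reverse.map μ').flatten).filter p =
        (a :: μ i ++ a :: μ' i).filter p := by
    intro p i hp
    rw [hword_filter,
      flatten_map_eq_of_forall_ne hL (hmemL i) fun j hj => (hfilter_nil p j (hp j hj)).1,
      flatten_map_eq_of_forall_ne (List.nodup_reverse.2 hL) (List.mem_reverse.2 (hmemL i))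
        fun j hj => (hfilter_nil p j (hp j hj)).2]
    simp only [← List.filter_append]
    simp
  have hnotmem : ∀ {i j x y}, j ≠ i → x ∈ insert a (D i) → y ∈ D j → y ≠ x := by
    rintro i j x y hji hx hy rfl
    rcases Finset.mem_insert.1 hx with rfl | hx
    · have : y ∈ Finset.univ.biUnion D := Finset.mem_biUnion.2 ⟨j, Finset.mem_univ _, hy⟩
      simp [hDcover] at this
    · exact Finset.disjoint_left.1 (hDdisj j i hji) hy hx
  have hcover : ∀ x, x ≠ a → ∃ i, x ∈ D i := by
    intro x hx
    have : x ∈ Finset.univ.biUnion D := by simp [hDcover, hx]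
    simpa using this
  have hcover' : ∀ x, ∃ i, x ∈ insert a (D i) := by
    intro x
    by_cases hx : x = a
    · exact ⟨⟨0, by omega⟩, by simp [hx]⟩
    · obtain ⟨i, hi⟩ := hcover x hx
      exact ⟨i, Finset.mem_insert_of_mem hi⟩
  have hcount : ∀ x,
      (a :: (L.map μ).flatten ++ a :: (L.reverse.map μ').flatten).count x = 2 := by
    intro x
    obtain ⟨i, hi⟩ := hcover' x
    rw [← (hmodel i).1 x hi, List.count_eq_length_filter, List.count_eq_length_filter,
      hlocal _ i fun j hj y hy => by simpa using hnotmem hj hi hy]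
  refine ⟨fun x _ => hcount x, fun x hx => absurd (Finset.mem_univ x) hx, ?_⟩
  intro u _ v _ huv
  rw [chordsAlternate_iff_filter huv (hcount u) (hcount v)]
  by_cases hsame : ∃ i, u ∈ insert a (D i) ∧ v ∈ insert a (D i)
  · obtain ⟨i, hu, hv⟩ := hsame
    rw [hlocal _ i fun j hj y hy => by simp [hnotmem hj hu hy, hnotmem hj hv hy],
      (hmodel i).2.2 u hu v hv huv,
      chordsAlternate_iff_filter huv ((hmodel i).1 u hu) ((hmodel i).1 v hv)]
  · have hua : u ≠ a := by
      rintro rfl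
      obtain ⟨i, hi⟩ := hcover' v
      exact hsame ⟨i, Finset.mem_insert_self _ _, hi⟩
    have hva : v ≠ a := by
      rintro rfl
      obtain ⟨i, hi⟩ := hcover' u
      exact hsame ⟨i, hi, Finset.mem_insert_self _ _⟩
    obtain ⟨i, hi⟩ := hcover u hua
    obtain ⟨j, hj⟩ := hcover v hva
    have hij : i ≠ j := by
      rintro rfl
      exact hsame ⟨i, Finset.mem_insert_of_mem hi, Finset.mem_insert_of_mem hj⟩
    have hi' : u ∈ insert a (D i) := Finset.mem_insert_of_mem hi
    have hj' : v ∈ insert a (D j) := Finset.mem_insert_of_mem hj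
    refine iff_of_false (hDsep i j hij u hi v hj) ?_
    have honly_u : ∀ x, x ∈ D i → x = u ∨ x = v → x = u := fun x hx h =>
      h.resolve_right (hnotmem hij hj' hx)
    have honly_v : ∀ x, x ∈ D j → x = u ∨ x = v → x = v := fun x hx h =>
      h.resolve_left (hnotmem hij.symm hi' hx)
    have hsu : ∀ x ∈ (μ i).filter (fun x => x = u ∨ x = v), x = u := fun x hx =>
      honly_u x (hletters i x (.inl (List.mem_of_mem_filter hx)))
        (by simpa using List.of_mem_filter hx)
    have hsu' : ∀ x ∈ (μ' i).filter (fun x => x = u ∨ x = v), x = u := fun x hx =>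
      honly_u x (hletters i x (.inr (List.mem_of_mem_filter hx)))
        (by simpa using List.of_mem_filter hx)
    have hsv : ∀ x ∈ (μ j).filter (fun x => x = u ∨ x = v), x = v := fun x hx =>
      honly_v x (hletters j x (.inl (List.mem_of_mem_filter hx)))
        (by simpa using List.of_mem_filter hx)
    have hsv' : ∀ x ∈ (μ' j).filter (fun x => x = u ∨ x = v), x = v := fun x hx =>
      honly_v x (hletters j x (.inr (List.mem_of_mem_filter hx)))
        (by simpa using List.of_mem_filter hx)
    have hfa : [a].filter (fun x => x = u ∨ x = v) = [] := by simp [hua.symm, hva.symm]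
    rw [hword_filter, hfa, List.nil_append, List.nil_append, not_or]
    rcases flatten_map_pair hL (hmemL i) (hmemL j) hij
      (g := fun m => (μ m).filter (fun x => x = u ∨ x = v))
      (g' := fun m => (μ' m).filter (fun x => x = u ∨ x = v))
      (fun m hmi hmj => hfilter_nil _ m fun y hy => by
        simp [hnotmem hmi hi' hy, hnotmem hmj hj' hy]) with ⟨e, e'⟩ | ⟨e, e'⟩
    · rw [e, e']
      exact nested_not_alternating huv hsu hsu' hsv hsv'
    · rw [e, e']
      exact (nested_not_alternating huv.symm hsv hsv' hsu hsu').symm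
end

section
/- Let G = (V, E) be a prime finite simple graph and let (y, x, X, α(X)) be a probe in G with P = {x, y} ∪ X ∪ α(X). Let Z = { z ∈ X : z is non-adjacent to every vertex of P ∖ {x, z} }. Then |Z| ≤ 1. -/
/-- `M` is a module of `G`: every vertex outside `M` is adjacent to all
vertices of `M` or to none of them. -/
def IsModule {V : Type*} (G : SimpleGraph V) (M : Finset V) : Prop :=
  ∀ v ∉ M, (∀ m ∈ M, G.Adj v m) ∨ (∀ m ∈ M, ¬ G.Adj v m)

/-- `M` is a non-trivial module of `G`. -/
def IsNontrivialModule {V : Type*} [Fintype V] (G : SimpleGraph V) (M : Finset V) : Prop :=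
  IsModule G M ∧ 2 ≤ M.card ∧ M ≠ Finset.univ

/-- `G` is prime: it has no non-trivial module. -/
def IsPrime {V : Type*} [Fintype V] (G : SimpleGraph V) : Prop :=
  ∀ M : Finset V, ¬ IsNontrivialModule G M

/-- `M` is a module of the subgraph of `G` induced on `P`. -/
def IsModuleOn {V : Type*} (G : SimpleGraph V) (P M : Finset V) : Prop :=
  M ⊆ P ∧ ∀ v ∈ P, v ∉ M → (∀ m ∈ M, G.Adj v m) ∨ (∀ m ∈ M, ¬ G.Adj v m)

/-- `(y, x, X, A)` is a probe in `G` (`A` plays the role of `α(X)`). -/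
def IsProbe {V : Type*} [Fintype V] [DecidableEq V] (G : SimpleGraph V)
    (y x : V) (X A : Finset V) : Prop :=
  -- (1) the sets `{x}`, `{y}`, `X`, `A` are nonempty, pairwise disjoint,
  -- and `P = {x, y} ∪ X ∪ A` is a proper subset of `V`:
  X.Nonempty ∧ A.Nonempty ∧ y ≠ x ∧
  x ∉ X ∧ x ∉ A ∧ y ∉ X ∧ y ∉ A ∧ Disjoint X A ∧
  insert x (insert y (X ∪ A)) ≠ Finset.univ ∧
  -- (2) `y ∼ x`, `y ∥ X ∪ A`, `x ∼ X`, `x ∥ A`, and the subgraph induced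
  -- on `P` is connected:
  G.Adj y x ∧
  (∀ v ∈ X ∪ A, ¬ G.Adj y v) ∧
  (∀ v ∈ X, G.Adj x v) ∧
  (∀ v ∈ A, ¬ G.Adj x v) ∧
  (G.induce ((insert x (insert y (X ∪ A)) : Finset V) : Set V)).Connected ∧
  -- (3) every vertex outside `P` is one of the three types:
  ∀ t ∉ insert x (insert y (X ∪ A)),
    (∀ v ∈ X ∪ A, ¬ G.Adj t v) ∨
    ((∀ v ∈ X, G.Adj t v) ∧ (∀ v ∈ A, ¬ G.Adj t v)) ∨
    (∀ v ∈ X ∪ A, G.Adj t v)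

theorem probe_Z_card_le_one
    {V : Type*} [Fintype V] [DecidableEq V] (G : SimpleGraph V) [DecidableRel G.Adj]
    (hprime : IsPrime G) (y x : V) (X A : Finset V)
    (hprobe : IsProbe G y x X A) :
    ((X.filter (fun z => ∀ w ∈ insert x (insert y (X ∪ A)),
        w ≠ x → w ≠ z → ¬ G.Adj z w)).card) ≤ 1 := by
  obtain ⟨-, -, -, hxX, -, -, -, -, -, -, -, hx, -, -, ht⟩ := hprobe
  by_contra hcard
  refine hprime _ ⟨fun v hv => ?_, Nat.lt_of_not_le hcard, fun huniv => ?_⟩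
  · by_cases hvP : v ∈ insert x (insert y (X ∪ A))
    · by_cases hvx : v = x
      · subst hvx
        exact Or.inl fun m hm => hx m (Finset.mem_filter.mp hm).1
      · exact Or.inr fun m hm hadj => (Finset.mem_filter.mp hm).2 v hvP hvx
          (fun h => hv (h ▸ hm)) hadj.symm
    · rcases ht v hvP with h | ⟨h, -⟩ | h
      · exact Or.inr fun m hm => h m (Finset.mem_union_left A (Finset.mem_filter.mp hm).1)
      · exact Or.inl fun m hm => h m (Finset.mem_filter.mp hm).1
      · exact Or.inl fun m hm => h m (Finset.mem_union_left A (Finset.mem_filter.mp hm).1)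
  · exact hxX (Finset.mem_filter.mp (huniv ▸ Finset.mem_univ x)).1
end

section
/- Let G = (V, E) be a prime finite simple graph and let (y, x, X, α(X)) be a probe in G with P = {x, y} ∪ X ∪ α(X). Let Z = { z ∈ X : z is non-adjacent to every vertex of P ∖ {x, z} }. Then every non-trivial module M of the subgraph of G induced on P is of the form M = {y, z} for some z ∈ Z. -/
/-- A set closed under adjacency contains everything reachable from its elements. -/
theorem SimpleGraph.Reachable.mem_of_adj_closed {W : Type*} {H : SimpleGraph W} {S : Set W}
    (hS : ∀ a b, H.Adj a b → a ∈ S → b ∈ S) {u v : W} (h : H.Reachable u v) (hu : u ∈ S) :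
    v ∈ S := by
  obtain ⟨p⟩ := h
  induction p with
  | nil => exact hu
  | cons hadj _ ih => exact ih (hS _ _ hadj hu)

/-- If no edge of a connected induced subgraph on `P` leaves the nonempty set `M ⊆ P`,
then `M = P`. -/
theorem eq_of_induce_connected_of_not_adj {V : Type*} {G : SimpleGraph V} {P M : Finset V}
    (hconn : (G.induce (P : Set V)).Connected) (hMP : M ⊆ P) (hM : M.Nonempty)
    (hadj : ∀ v ∈ P, v ∉ M → ∀ m ∈ M, ¬ G.Adj v m) : M = P := by
  obtain ⟨u, hu⟩ := hM
  refine hMP.antisymm fun v hv => ?_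
  refine (hconn.preconnected ⟨u, hMP hu⟩ ⟨v, hv⟩).mem_of_adj_closed
    (S := {w : (P : Set V) | (w : V) ∈ M}) (fun a b hab ha => ?_) hu
  by_contra hb
  exact hadj b b.2 hb a ha hab.symm

/-- A module of the subgraph induced on `P` that every vertex outside `P` fails to split is a
module of the whole graph. -/
theorem IsModuleOn.isModule {V : Type*} {G : SimpleGraph V} {P M : Finset V}
    (hmod : IsModuleOn G P M)
    (hout : ∀ t ∉ P, (∀ m ∈ M, G.Adj t m) ∨ (∀ m ∈ M, ¬ G.Adj t m)) : IsModule G M := by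
  intro v hv
  by_cases hvP : v ∈ P
  · exact hmod.2 v hvP hv
  · exact hout v hvP

/-- In a prime graph, a module of the subgraph induced on the vertex set of a probe that lies
inside `X` or inside `A` has at most one vertex. -/
theorem IsModuleOn.card_lt_two_of_isProbe {V : Type*} [Fintype V] [DecidableEq V]
    {G : SimpleGraph V} (hprime : IsPrime G) {y x : V} {X A M : Finset V}
    (hprobe : IsProbe G y x X A) (hmod : IsModuleOn G (insert x (insert y (X ∪ A))) M)
    (hM : M ⊆ X ∨ M ⊆ A) : M.card < 2 := by
  obtain ⟨-, -, -, hxX, hxA, -, -, -, -, -, -, -, -, -, hout⟩ := hprobe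
  by_contra! hcard
  refine hprime M ⟨hmod.isModule fun t ht => ?_, hcard, ?_⟩
  · have := hout t ht
    simp only [Finset.mem_union] at this
    rcases hM with hM | hM
    · rcases this with h | h | h
      · exact .inr fun m hm => h m (.inl (hM hm))
      · exact .inl fun m hm => h.1 m (hM hm)
      · exact .inl fun m hm => h m (.inl (hM hm))
    · rcases this with h | h | h
      · exact .inr fun m hm => h m (.inr (hM hm))
      · exact .inr fun m hm => h.2 m (hM hm)
      · exact .inl fun m hm => h m (.inr (hM hm))
  · rintro rfl
    rcases hM with hM | hM
    · exact hxX (hM (Finset.mem_univ x))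
    · exact hxA (hM (Finset.mem_univ x))


theorem probe_nontrivial_modules_are_yz
    {V : Type*} [Fintype V] [DecidableEq V] (G : SimpleGraph V)
    (hprime : IsPrime G) (y x : V) (X A : Finset V)
    (hprobe : IsProbe G y x X A)
    (M : Finset V)
    (hmod : IsModuleOn G (insert x (insert y (X ∪ A))) M)
    (hcard : 2 ≤ M.card) (hne : M ≠ insert x (insert y (X ∪ A))) :
    ∃ z ∈ X, (∀ w ∈ insert x (insert y (X ∪ A)), w ≠ x → w ≠ z → ¬ G.Adj z w) ∧
      M = {y, z} := by
  have hsmall := fun N hN => IsModuleOn.card_lt_two_of_isProbe (M := N) hprime hprobe hN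
  obtain ⟨-, -, hyx, hxX, hxA, hyX, hyA, -, -, hadj, hy, hX, hA, hconn, -⟩ := hprobe
  obtain ⟨hMP, hsplit⟩ := hmod
  have hMP' : ∀ m ∈ M, m = x ∨ m = y ∨ m ∈ X ∨ m ∈ A := fun m hm => by
    simpa using hMP hm
  have hyP : y ∈ insert x (insert y (X ∪ A)) := by simp
  have hxP : x ∈ insert x (insert y (X ∪ A)) := by simp
  by_cases hxM : x ∈ M
  · exfalso
    by_cases hyM : y ∈ M
    · refine hne (eq_of_induce_connected_of_not_adj hconn hMP ⟨x, hxM⟩ fun v hv hvM => ?_)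
      refine (hsplit v hv hvM).resolve_left fun h => ?_
      have hvXA : v ∈ X ∪ A := by
        simp only [Finset.mem_insert] at hv
        rcases hv with rfl | rfl | hv
        · exact absurd hxM hvM
        · exact absurd hyM hvM
        · exact hv
      exact hy v hvXA (h y hyM).symm
    · have hall : ∀ m ∈ M, G.Adj y m :=
        (hsplit y hyP hyM).resolve_right fun h => h x hxM hadj
      have hsub : M ⊆ {x} := fun m hm => by
        rcases hMP' m hm with rfl | rfl | h | h
        · simp
        · exact absurd hm hyM
        · exact absurd (hall m hm) (hy m (by simp [h]))
        · exact absurd (hall m hm) (hy m (by simp [h]))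
      have := Finset.card_le_card hsub
      simp only [Finset.card_singleton] at this
      omega
  by_cases hyM : y ∈ M
  · have hall : ∀ m ∈ M, G.Adj x m :=
      (hsplit x hxP hxM).resolve_right fun h => h y hyM hadj.symm
    have hsub : M.erase y ⊆ X := fun m hm => by
      obtain ⟨hmy, hm⟩ := Finset.mem_erase.1 hm
      rcases hMP' m hm with rfl | rfl | h | h
      · exact absurd hm hxM
      · exact absurd rfl hmy
      · exact h
      · exact absurd (hall m hm) (hA m h)
    have hnonadj : ∀ v ∈ X ∪ A, v ∉ M → ∀ m ∈ M, ¬ G.Adj v m := fun v hv hvM =>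
      (hsplit v (by simp only [Finset.mem_insert]; exact .inr (.inr hv)) hvM).resolve_left
        fun h => hy v hv (h y hyM).symm
    have hmod' : IsModuleOn G (insert x (insert y (X ∪ A))) (M.erase y) := by
      refine ⟨(Finset.erase_subset _ _).trans hMP, fun v hv hvM => ?_⟩
      by_cases hvy : v = y
      · subst hvy
        exact .inr fun m hm => hy m (Finset.mem_union_left _ (hsub hm))
      · have hvM' : v ∉ M := fun h => hvM (Finset.mem_erase.2 ⟨hvy, h⟩)
        exact (hsplit v hv hvM').imp (fun h m hm => h m (Finset.mem_of_mem_erase hm))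
          (fun h m hm => h m (Finset.mem_of_mem_erase hm))
    have hlt := hsmall _ hmod' (.inl hsub)
    have hcard' := Finset.card_erase_of_mem hyM
    obtain ⟨z, hz⟩ := Finset.card_eq_one.1 (by omega : (M.erase y).card = 1)
    have hMyz : M = {y, z} := by rw [← Finset.insert_erase hyM, hz]
    have hzX : z ∈ X := hsub (by simp [hz])
    refine ⟨z, hzX, fun w hw hwx hwz hzw => ?_, hMyz⟩
    simp only [Finset.mem_insert] at hw
    rcases hw with rfl | rfl | hw
    · exact hwx rfl
    · exact hy z (Finset.mem_union_left _ hzX) hzw.symm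
    · have hwy : w ≠ y := by
        rintro rfl
        simp [hyX, hyA] at hw
      exact hnonadj w hw (by simp [hMyz, hwy, hwz]) z (by simp [hMyz]) hzw.symm
  · have hXA : M ⊆ X ∨ M ⊆ A := by
      have hMXA : ∀ m ∈ M, m ∈ X ∨ m ∈ A := fun m hm => by
        rcases hMP' m hm with rfl | rfl | h
        · exact absurd hm hxM
        · exact absurd hm hyM
        · exact h
      refine (hsplit x hxP hxM).imp (fun h m hm => ?_) (fun h m hm => ?_)
      · exact (hMXA m hm).resolve_right fun hmA => hA m hmA (h m hm)
      · exact (hMXA m hm).resolve_left fun hmX => h m hm (hX m hmX)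
    have := hsmall M ⟨hMP, hsplit⟩ hXA
    omega
end
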